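/- arXiv:1305.7112 — 2 statements merged into one kernel-verified Lean document; each statement's English description precedes it below -/
import Mathlib

section
/- Let k > 0 be an integer and let G be a finite simple graph. If tw(G) ≥ 6k⁴ − 24k³ + 48k² − 48k + 23, then G contains the yurt graph Y_k as a minor. -/
/-- `IsMinor H G` : there is a minor model of `H` in `G`. -/
def IsMinor {α : Type*} {β : Type*} (H : SimpleGraph α) (G : SimpleGraph β) : Prop :=
  ∃ M : α → Set β,
    (∀ v, (G.induce (M v)).Connected) ∧
    (Pairwise fun u v => Disjoint (M u) (M v)) ∧
    (∀ ⦃u v : α⦄, H.Adj u v → ∃ a ∈ M u, ∃ b ∈ M v, G.Adj a b)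

/-- The treewidth of a finite simple graph: the least `w` such that `G` admits a tree
decomposition all of whose bags have at most `w + 1` vertices. -/
noncomputable def treewidth {V : Type*} [Fintype V] (G : SimpleGraph V) : ℕ :=
  sInf { w : ℕ | ∃ (ι : Type) (_ : Fintype ι) (t : SimpleGraph ι) (bag : ι → Finset V),
    t.IsTree ∧
    (∀ v : V, ∃ i, v ∈ bag i) ∧
    (∀ u v : V, G.Adj u v → ∃ i, u ∈ bag i ∧ v ∈ bag i) ∧
    (∀ v : V, (t.induce {i : ι | v ∈ bag i}).Connected) ∧
    (∀ i, (bag i).card ≤ w + 1) }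

/-- The yurt graph of order `r` : a `2 × r` grid with bottom row `x_i = some (i, 0)`
and top row `y_i = some (i, 1)` (edges `x_i x_(i+1)`, `y_i y_(i+1)` and `x_i y_i`),
together with an extra vertex `o = none` adjacent to every top-row vertex `y_i`. -/
def yurt (r : ℕ) : SimpleGraph (Option (Fin r × Fin 2)) :=
  SimpleGraph.fromRel (fun u v =>
    match u, v with
    | none, some q => q.2 = 1
    | some p, some q =>
        (p.2 = q.2 ∧ (q.1 : ℕ) = (p.1 : ℕ) + 1) ∨ (p.1 = q.1 ∧ p.2 = 0 ∧ q.2 = 1)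
    | _, _ => False)

namespace YurtMinor

open SimpleGraph

variable {V : Type*} {G H : SimpleGraph V}

/-- `Conn G K` : the vertex set `K` induces a connected subgraph of `G`, phrased as an induction
principle: a subset of `K` which is met by `K` and closed under adjacency in `K` is all of `K`. -/
def Conn (G : SimpleGraph V) (K : Set V) : Prop :=
  K.Nonempty ∧ ∀ U : Set V, (∃ u ∈ K, u ∈ U) →
    (∀ u ∈ K, u ∈ U → ∀ v ∈ K, G.Adj u v → v ∈ U) → K ⊆ U

theorem Conn.induce_connected {K : Set V} (h : Conn G K) : (G.induce K).Connected := by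
  obtain ⟨⟨r, hr⟩, h⟩ := h
  have key := h {v | ∃ hv : v ∈ K, (G.induce K).Reachable ⟨r, hr⟩ ⟨v, hv⟩} ⟨r, hr, hr, .refl _⟩ (by
    rintro u hu ⟨_, hru⟩ v hv huv
    exact ⟨hv, hru.trans (Adj.reachable (G := G.induce K) (u := ⟨u, hu⟩) (v := ⟨v, hv⟩) huv)⟩)
  refine (connected_iff_exists_forall_reachable _).2 ⟨⟨r, hr⟩, ?_⟩
  rintro ⟨v, hv⟩
  exact (key hv).2

theorem conn_singleton (v : V) : Conn G {v} := by
  refine ⟨⟨v, rfl⟩, ?_⟩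
  rintro U ⟨u, rfl, hu⟩ - w rfl
  exact hu

theorem Conn.mono {K : Set V} (h : Conn G K) (hGH : G ≤ H) : Conn H K :=
  ⟨h.1, fun U hU hcl => h.2 U hU fun u hu huU v hv huv => hcl u hu huU v hv (hGH huv)⟩

theorem Conn.exists_adj {K U : Set V} (h : Conn G K) (hKU : ∃ u ∈ K, u ∈ U)
    (hne : ∃ v ∈ K, v ∉ U) : ∃ u ∈ K, u ∈ U ∧ ∃ v ∈ K, v ∉ U ∧ G.Adj u v := by
  by_contra! hc
  obtain ⟨v, hv, hvU⟩ := hne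
  exact hvU (h.2 U hKU (fun u hu huU v hv huv => by_contra fun hvU => hc u hu huU v hv hvU huv) hv)

/-- A union of connected sets, each containing a common vertex `r`, is connected. -/
theorem conn_sUnion {S : Set (Set V)} {r : V} (hne : S.Nonempty) (h : ∀ K ∈ S, Conn G K)
    (hr : ∀ K ∈ S, r ∈ K) : Conn G (⋃₀ S) := by
  obtain ⟨K₀, hK₀⟩ := hne
  refine ⟨⟨r, K₀, hK₀, hr _ hK₀⟩, ?_⟩
  rintro U ⟨u, ⟨K, hK, huK⟩, huU⟩ hcl
  have sub : ∀ L ∈ S, (∃ u ∈ L, u ∈ U) → L ⊆ U := fun L hL hu =>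
    (h L hL).2 U hu fun u hu huU v hv huv => hcl u ⟨L, hL, hu⟩ huU v ⟨L, hL, hv⟩ huv
  have hrU : r ∈ U := sub K hK ⟨u, huK, huU⟩ (hr K hK)
  rintro v ⟨L, hL, hv⟩
  exact sub L hL ⟨r, hr L hL, hrU⟩ hv

theorem Conn.union_of_mem {K L : Set V} {r : V} (hK : Conn G K) (hL : Conn G L) (hrK : r ∈ K)
    (hrL : r ∈ L) : Conn G (K ∪ L) := by
  have := conn_sUnion (G := G) (S := {K, L}) (r := r) ⟨K, by simp⟩ (by simp [hK, hL])
    (by simp [hrK, hrL])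
  simpa using this

theorem Conn.union_of_adj {K L : Set V} {a b : V} (hK : Conn G K) (hL : Conn G L) (ha : a ∈ K)
    (hb : b ∈ L) (hab : G.Adj a b) : Conn G (K ∪ L) := by
  refine ⟨⟨a, .inl ha⟩, ?_⟩
  rintro U ⟨u, hu, huU⟩ hcl
  have sK : (∃ u ∈ K, u ∈ U) → K ⊆ U := fun h =>
    hK.2 U h fun u hu huU v hv huv => hcl u (.inl hu) huU v (.inl hv) huv
  have sL : (∃ u ∈ L, u ∈ U) → L ⊆ U := fun h =>
    hL.2 U h fun u hu huU v hv huv => hcl u (.inr hu) huU v (.inr hv) huv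
  rcases hu with hu | hu
  · have h1 := sK ⟨u, hu, huU⟩
    exact Set.union_subset h1 (sL ⟨b, hb, hcl a (.inl ha) (h1 ha) b (.inr hb) hab⟩)
  · have h1 := sL ⟨u, hu, huU⟩
    exact Set.union_subset (sK ⟨a, ha, hcl b (.inr hb) (h1 hb) a (.inl ha) hab.symm⟩) h1

theorem Conn.subset_of_adj {K W : Set V} {r : V} (hK : Conn G K) (hr : r ∈ K) (hrW : r ∈ W)
    (hW : ∀ u v, G.Adj u v → v ∈ W) : K ⊆ W :=
  hK.2 W ⟨r, hr, hrW⟩ fun u _ _ v _ huv => hW u v huv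

/-- `IsComp G K C` : the set `C` is a connected component of the subgraph induced by `K`. -/
structure IsComp (G : SimpleGraph V) (K C : Set V) : Prop where
  sub : C ⊆ K
  conn : Conn G C
  closed : ∀ u ∈ C, ∀ v ∈ K, G.Adj u v → v ∈ C

theorem exists_isComp (G : SimpleGraph V) {K : Set V} {v : V} (hv : v ∈ K) :
    ∃ C, IsComp G K C ∧ v ∈ C := by
  have hc : Conn G (⋃₀ {C | C ⊆ K ∧ Conn G C ∧ v ∈ C}) :=
    conn_sUnion (r := v) ⟨{v}, by simpa, conn_singleton v, rfl⟩ (fun _ h => h.2.1)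
      (fun _ h => h.2.2)
  have hvC : v ∈ ⋃₀ {C | C ⊆ K ∧ Conn G C ∧ v ∈ C} :=
    ⟨{v}, ⟨by simpa, conn_singleton v, rfl⟩, rfl⟩
  have hs : ⋃₀ {C | C ⊆ K ∧ Conn G C ∧ v ∈ C} ⊆ K := Set.sUnion_subset fun _ h => h.1
  refine ⟨_, ⟨hs, hc, fun u hu w hw huw => ?_⟩, hvC⟩
  exact ⟨_, ⟨Set.union_subset hs (Set.singleton_subset_iff.2 hw),
    hc.union_of_adj (conn_singleton w) hu rfl huw, .inl hvC⟩, .inr rfl⟩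

theorem IsComp.subset_of_conn {K C D : Set V} (hC : IsComp G K C) (hD : Conn G D) (hDK : D ⊆ K)
    (h : ∃ u ∈ D, u ∈ C) : D ⊆ C :=
  hD.2 C h fun u _ huC v hv huv => hC.closed u huC v (hDK hv) huv

theorem IsComp.eq_of_mem {K C D : Set V} (hC : IsComp G K C) (hD : IsComp G K D) {v : V}
    (hvC : v ∈ C) (hvD : v ∈ D) : C = D :=
  (hD.subset_of_conn hC.conn hC.sub ⟨v, hvC, hvD⟩).antisymm
    (hC.subset_of_conn hD.conn hD.sub ⟨v, hvD, hvC⟩)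

/-- A component of a connected set minus a vertex `x` has a neighbour of `x`. -/
theorem IsComp.exists_adj_of_diff_singleton {K C : Set V} {x : V} (hK : Conn G K) (hx : x ∈ K)
    (hC : IsComp G (K \ {x}) C) : ∃ u ∈ C, G.Adj x u := by
  obtain ⟨c, hc⟩ := hC.conn.1
  obtain ⟨u, -, huC, v, hv, hvC, huv⟩ := hK.exists_adj (U := C) ⟨c, (hC.sub hc).1, hc⟩
    ⟨x, hx, fun h => (hC.sub h).2 rfl⟩
  by_cases hvx : v = x
  · exact ⟨u, huC, hvx ▸ huv.symm⟩
  · exact absurd (hC.closed u huC v ⟨hv, hvx⟩ huv) hvC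

/-- Two distinct nonadjacent vertices of a connected set `K` are both adjacent to some connected
set of other vertices of `K`. -/
theorem Conn.exists_between {K : Set V} {x y : V} (hK : Conn G K) (hx : x ∈ K) (hy : y ∈ K)
    (hne : x ≠ y) (hadj : ¬ G.Adj x y) :
    ∃ I ⊆ K \ {x, y}, Conn G I ∧ (∃ u ∈ I, G.Adj x u) ∧ ∃ u ∈ I, G.Adj y u := by
  obtain ⟨D, hD, hyD⟩ := exists_isComp G (K := K \ {x}) (v := y) ⟨hy, hne.symm⟩
  obtain ⟨u, huD, hxu⟩ := hD.exists_adj_of_diff_singleton hK hx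
  obtain ⟨I, hI, huI⟩ := exists_isComp G (K := D \ {y}) (v := u)
    ⟨huD, by rintro rfl; exact hadj hxu⟩
  refine ⟨I, fun v hv => ?_, hI.conn, ⟨u, huI, hxu⟩, hI.exists_adj_of_diff_singleton hD.conn hyD⟩
  have h1 := hI.sub hv
  have h2 := hD.sub h1.1
  exact ⟨h2.1, by simpa using ⟨h2.2, h1.2⟩⟩

/-! ### The Menger theorem -/

/-- `(C, D)` is a separation of `G` between `A` and `B`. -/
structure IsSep (G : SimpleGraph V) (A B C D : Set V) : Prop where
  left : A ⊆ C
  right : B ⊆ D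
  cover : ∀ v, v ∈ C ∨ v ∈ D
  adj : ∀ u v, G.Adj u v → u ∈ C → u ∉ D → v ∈ C

theorem IsSep.symm {A B C D : Set V} (h : IsSep G A B C D) : IsSep G B A D C where
  left := h.right
  right := h.left
  cover v := (h.cover v).symm
  adj u v huv huD huC := by
    by_contra hv
    exact huC (h.adj v u huv.symm ((h.cover v).resolve_right hv) hv)

/-- The edges of `G` with both ends in `C`. -/
def within (G : SimpleGraph V) (C : Set V) : SimpleGraph V where
  Adj u v := G.Adj u v ∧ u ∈ C ∧ v ∈ C
  symm := ⟨fun _ _ h => ⟨h.1.symm, h.2.2, h.2.1⟩⟩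
  loopless := ⟨fun _ h => h.1.ne rfl⟩

theorem within_le (G : SimpleGraph V) (C : Set V) : within G C ≤ G := fun _ _ h => h.1

/-- There are `k` disjoint connected sets, each with exactly one vertex in `A` and exactly one
vertex in `B`. -/
def Linked (G : SimpleGraph V) (A B : Set V) (k : ℕ) : Prop :=
  ∃ P : Fin k → Set V, (∀ i, Conn G (P i)) ∧ (Pairwise fun i j => Disjoint (P i) (P j)) ∧
    (∀ i, ∃ a, P i ∩ A = {a}) ∧ ∀ i, ∃ b, P i ∩ B = {b}

theorem Linked.mono {A B : Set V} {k : ℕ} (h : Linked G A B k) (hGH : G ≤ H) :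
    Linked H A B k := by
  obtain ⟨P, h1, h2⟩ := h
  exact ⟨P, fun i => (h1 i).mono hGH, h2⟩

theorem eq_of_inter_eq_singleton {S T : Set V} (h : ∃ a, S ∩ T = {a}) {u v : V} (hu : u ∈ S)
    (hu' : u ∈ T) (hv : v ∈ S) (hv' : v ∈ T) : u = v := by
  obtain ⟨a, ha⟩ := h
  have h1 : u ∈ S ∩ T := ⟨hu, hu'⟩
  have h2 : v ∈ S ∩ T := ⟨hv, hv'⟩
  rw [ha] at h1 h2
  exact h1.trans h2.symm

theorem exists_mem_of_unique {T : Set V} {k : ℕ} [Finite V] (hT : T.ncard ≤ k) {P : Fin k → Set V}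
    (hd : Pairwise fun i j => Disjoint (P i) (P j)) (hP : ∀ i, ∃ a, P i ∩ T = {a}) {t : V}
    (ht : t ∈ T) : ∃ i, t ∈ P i := by
  choose f hf using hP
  have hfP : ∀ i, f i ∈ P i ∩ T := fun i => by rw [hf]; rfl
  have hinj : Function.Injective f := fun i j hij => by
    by_contra hne
    exact Set.disjoint_left.1 (hd hne) (hfP i).1 (hij ▸ (hfP j).1)
  have hr : Set.range f = T := by
    refine Set.eq_of_subset_of_ncard_le (Set.range_subset_iff.2 fun i => (hfP i).2) ?_
      (Set.toFinite T)
    rw [← Set.image_univ, Set.ncard_image_of_injective _ hinj, Set.ncard_univ, Nat.card_fin]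
    exact hT
  obtain ⟨i, rfl⟩ : t ∈ Set.range f := hr ▸ ht
  exact ⟨i, (hfP i).1⟩

/-- If the edges leaving `C \ D` start in `T ⊇ C ∩ D`, then every separation of `G[C]` between `A`
and `T` extends to a separation of `G` between `A` and `B` of no larger order. -/
theorem le_ncard_of_isSep_within [Finite V] {A B C D T C' D' : Set V} {k : ℕ}
    (h : ∀ C D, IsSep G A B C D → k ≤ (C ∩ D).ncard) (hA : A ⊆ C) (hB : B ⊆ D)
    (hcover : ∀ v, v ∈ C ∨ v ∈ D)
    (hadj : ∀ u v, G.Adj u v → u ∈ C → u ∉ D → v ∉ C → u ∈ T) (hT : C ∩ D ⊆ T)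
    (hs : IsSep (within G C) A T C' D') : k ≤ (C' ∩ D').ncard := by
  refine (h (C' ∩ C) (D' ∪ D) ⟨Set.subset_inter hs.left hA, hB.trans Set.subset_union_right,
    fun v => ?_, ?_⟩).trans (Set.ncard_le_ncard ?_ (Set.toFinite _))
  · have := hs.cover v
    have := hcover v
    grind
  · rintro u v huv ⟨huC', huC⟩ huD
    have huD' : u ∉ D' := fun h => huD (.inl h)
    have hvC : v ∈ C := by
      by_contra hvC
      exact huD' (hs.right (hadj u v huv huC (fun h => huD (.inr h)) hvC))
    exact ⟨hs.adj u v ⟨huv, huC, hvC⟩ huC' huD', hvC⟩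
  · rintro v ⟨⟨hvC', hvC⟩, hv | hv⟩
    · exact ⟨hvC', hv⟩
    · exact ⟨hvC', hs.right (hT ⟨hvC, hv⟩)⟩

theorem Linked.trans_edge [Finite V] {A B C D : Set V} {x y : V} {k : ℕ} (hA : A ⊆ C) (hB : B ⊆ D)
    (hxy : G.Adj x y) (hx : x ∉ D) (hy : y ∉ C) (hk : (C ∩ D).ncard < k)
    (hP : Linked (within G C) A (insert x (C ∩ D)) k)
    (hQ : Linked (within G D) B (insert y (C ∩ D)) k) : Linked G A B k := by
  obtain ⟨P, hPc, hPd, hPA, hPT⟩ := hP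
  obtain ⟨Q, hQc, hQd, hQB, hQT⟩ := hQ
  have hPC : ∀ i, P i ⊆ C := fun i => by
    obtain ⟨a, ha⟩ := hPA i
    have : a ∈ P i ∩ A := ha ▸ rfl
    exact (hPc i).subset_of_adj this.1 (hA this.2) fun u v h => h.2.2
  have hQD : ∀ i, Q i ⊆ D := fun i => by
    obtain ⟨a, ha⟩ := hQB i
    have : a ∈ Q i ∩ B := ha ▸ rfl
    exact (hQc i).subset_of_adj this.1 (hB this.2) fun u v h => h.2.2
  have hle : (insert y (C ∩ D)).ncard ≤ k := (Set.ncard_insert_le _ _).trans hk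
  have hσ : ∀ i, ∃ j, (∃ s ∈ C ∩ D, s ∈ P i ∧ s ∈ Q j) ∨ (x ∈ P i ∧ y ∈ Q j) := fun i => by
    obtain ⟨t, ht⟩ := hPT i
    obtain ⟨hti, ht⟩ : t ∈ P i ∩ insert x (C ∩ D) := ht ▸ rfl
    rcases ht with rfl | ht
    · obtain ⟨j, hj⟩ := exists_mem_of_unique hle hQd hQT (Set.mem_insert y _)
      exact ⟨j, .inr ⟨hti, hj⟩⟩
    · obtain ⟨j, hj⟩ := exists_mem_of_unique hle hQd hQT (Set.mem_insert_of_mem y ht)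
      exact ⟨j, .inl ⟨t, ht, hti, hj⟩⟩
  choose σ hσ using hσ
  have hPQ : ∀ i i' z, z ∈ P i → z ∈ Q (σ i') → z ∈ P i' := fun i i' z hz hz' => by
    have hzS : z ∈ C ∩ D := ⟨hPC i hz, hQD _ hz'⟩
    rcases hσ i' with ⟨s, hs, hsP, hsQ⟩ | ⟨_, hyQ⟩
    · rwa [eq_of_inter_eq_singleton (hQT (σ i')) hz' (.inr hzS) hsQ (.inr hs)]
    · exact absurd hzS.1 (eq_of_inter_eq_singleton (hQT (σ i')) hz' (.inr hzS) hyQ (.inl rfl) ▸ hy)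
  have hdisj : ∀ {i j}, i ≠ j → ∀ z, z ∈ P i → z ∉ P j := fun hij z hz hz' =>
    Set.disjoint_left.1 (hPd hij) hz hz'
  refine ⟨fun i => P i ∪ Q (σ i), fun i => ?_, fun i j hij => ?_, fun i => ?_, fun i => ?_⟩
  · have h1 := (hPc i).mono (within_le _ _)
    have h2 := (hQc (σ i)).mono (within_le _ _)
    rcases hσ i with ⟨s, -, hsP, hsQ⟩ | ⟨hxP, hyQ⟩
    · exact h1.union_of_mem h2 hsP hsQ
    · exact h1.union_of_adj h2 hxP hyQ hxy
  · refine Set.disjoint_left.2 ?_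
    rintro z (hz | hz) (hz' | hz')
    · exact hdisj hij z hz hz'
    · exact hdisj hij z hz (hPQ i j z hz hz')
    · exact hdisj hij z (hPQ j i z hz' hz) hz'
    · by_cases hσij : σ i = σ j
      · rcases hσ i with ⟨s, hs, hsP, hsQ⟩ | ⟨hxP, hyQ⟩
        · exact hdisj hij s hsP (hPQ i j s hsP (hσij ▸ hsQ))
        · rcases hσ j with ⟨s, hs, hsP, hsQ⟩ | ⟨hxP', _⟩
          · exact hdisj hij s (hPQ j i s hsP (hσij ▸ hsQ)) hsP
          · exact hdisj hij x hxP hxP'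
      · exact Set.disjoint_left.1 (hQd hσij) hz hz'
  · obtain ⟨a, ha⟩ := hPA i
    refine ⟨a, ?_⟩
    rw [← ha]
    refine Set.Subset.antisymm ?_ (Set.inter_subset_inter_left _ Set.subset_union_left)
    rintro z ⟨hz | hz, hzA⟩
    · exact ⟨hz, hzA⟩
    · have hzS : z ∈ C ∩ D := ⟨hA hzA, hQD _ hz⟩
      refine ⟨?_, hzA⟩
      rcases hσ i with ⟨s, hs, hsP, hsQ⟩ | ⟨_, hyQ⟩
      · rwa [eq_of_inter_eq_singleton (hQT (σ i)) hz (.inr hzS) hsQ (.inr hs)]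
      · exact absurd hzS.1 (eq_of_inter_eq_singleton (hQT (σ i)) hz (.inr hzS) hyQ (.inl rfl) ▸ hy)
  · obtain ⟨b, hb⟩ := hQB (σ i)
    refine ⟨b, ?_⟩
    rw [← hb]
    refine Set.Subset.antisymm ?_ (Set.inter_subset_inter_left _ Set.subset_union_right)
    rintro z ⟨hz | hz, hzB⟩
    · have hzS : z ∈ C ∩ D := ⟨hPC _ hz, hB hzB⟩
      refine ⟨?_, hzB⟩
      rcases hσ i with ⟨s, hs, hsP, hsQ⟩ | ⟨hxP, _⟩
      · rwa [eq_of_inter_eq_singleton (hPT i) hz (.inr hzS) hsP (.inr hs)]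
      · exact absurd hzS.2 (eq_of_inter_eq_singleton (hPT i) hz (.inr hzS) hxP (.inl rfl) ▸ hx)
    · exact ⟨hz, hzB⟩

/-- The Menger theorem for vertex sets, with connected sets in place of paths. -/
theorem menger [Finite V] (G : SimpleGraph V) (A B : Set V) (k : ℕ)
    (h : ∀ C D, IsSep G A B C D → k ≤ (C ∩ D).ncard) : Linked G A B k := by
  induction G using WellFoundedLT.induction generalizing A B with
  | ind G ih =>
  by_cases hG : ∃ x y, G.Adj x y
  · obtain ⟨x, y, hxy⟩ := hG
    by_cases hdel : ∀ C D, IsSep (G.deleteEdges {s(x, y)}) A B C D → k ≤ (C ∩ D).ncard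
    · have hlt : G.deleteEdges {s(x, y)} < G := by
        refine lt_of_le_of_ne (deleteEdges_le _) fun h => ?_
        rw [← h] at hxy
        simp at hxy
      exact (ih _ hlt A B hdel).mono (deleteEdges_le _)
    · push Not at hdel
      obtain ⟨C, D, hs, hlt⟩ := hdel
      have hcross : ∀ u v, G.Adj u v → u ∈ C → u ∉ D → v ∉ C → s(u, v) = s(x, y) :=
        fun u v huv huC huD hvC => by
          by_contra hne
          exact hvC (hs.adj u v (by simp [deleteEdges_adj, huv, hne]) huC huD)
      have key : ∀ x y, G.Adj x y →
          (∀ u v, G.Adj u v → u ∈ C → u ∉ D → v ∉ C → s(u, v) = s(x, y)) →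
          x ∈ C → x ∉ D → y ∉ C → Linked G A B k := by
        intro x y hxy hcross hxC hxD hyC
        have hlt1 : within G C < G := by
          refine lt_of_le_of_ne (within_le _ _) fun h => hyC ?_
          rw [← h] at hxy
          exact hxy.2.2
        have hlt2 : within G D < G := by
          refine lt_of_le_of_ne (within_le _ _) fun h => hxD ?_
          rw [← h] at hxy
          exact hxy.2.1
        refine Linked.trans_edge hs.left hs.right hxy hxD hyC hlt (ih _ hlt1 _ _ fun C' D' h' => ?_)
          (ih _ hlt2 _ _ fun C' D' h' => ?_)
        · refine le_ncard_of_isSep_within h hs.left hs.right hs.cover ?_ (Set.subset_insert _ _) h'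
          intro u v huv huC huD hvC
          have := hcross u v huv huC huD hvC
          grind
        · refine le_ncard_of_isSep_within (B := A)
            (fun C D hCD => Set.inter_comm D C ▸ h D C hCD.symm) hs.right hs.left
            (fun v => (hs.cover v).symm) ?_ (by rw [Set.inter_comm]; exact Set.subset_insert _ _) h'
          intro u v huv huD huC hvD
          have := hcross v u huv.symm ((hs.cover v).resolve_right hvD) hvD huC
          grind
      have hne : ¬ IsSep G A B C D := fun hs' => (h C D hs').not_gt hlt
      obtain ⟨u, v, huv, huC, huD, hvC⟩ :
          ∃ u v, G.Adj u v ∧ u ∈ C ∧ u ∉ D ∧ v ∉ C := by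
        by_contra! hc
        exact hne ⟨hs.left, hs.right, hs.cover, hc⟩
      exact key u v huv (fun a b hab ha ha' hb => (hcross a b hab ha ha' hb).trans
        (hcross u v huv huC huD hvC).symm) huC huD hvC
  · push Not at hG
    have hle : k ≤ (A ∩ B).ncard := by
      have := h A (B ∪ Aᶜ) ⟨subset_rfl, Set.subset_union_left, fun v => by
        by_cases hv : v ∈ A <;> simp [hv], fun u v huv => absurd huv (hG u v)⟩
      rwa [Set.inter_union_distrib_left, Set.inter_compl_self, Set.union_empty] at this
    obtain ⟨T, hTs, hT⟩ := Set.exists_subset_card_eq hle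
    have e : T ≃ Fin k := by
      rw [← Nat.card_coe_set_eq] at hT
      exact Finite.equivFinOfCardEq hT
    refine ⟨fun i => {(e.symm i : V)}, fun i => conn_singleton _, fun i j hij => ?_,
      fun i => ⟨_, Set.inter_eq_left.2 (Set.singleton_subset_iff.2 (hTs (e.symm i).2).1)⟩,
      fun i => ⟨_, Set.inter_eq_left.2 (Set.singleton_subset_iff.2 (hTs (e.symm i).2).2)⟩⟩
    refine Set.disjoint_singleton.2 fun h => hij (e.symm.injective (Subtype.ext h))

/-! ### Tree decompositions from recursive separators -/

/-- The vertices outside `K` with a neighbour in `K`. -/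
def nbr (G : SimpleGraph V) (K : Set V) : Set V := {v | v ∉ K ∧ ∃ u ∈ K, G.Adj u v}

/-- `Small G N K` : the set `K` can be recursively separated, starting from its neighbourhood, using
sets of size at most `N`. -/
inductive Small (G : SimpleGraph V) (N : ℕ) : Set V → Prop
  | mk (K S : Set V) (hcard : (nbr G K ∪ S).ncard ≤ N)
      (hcomp : ∀ C, IsComp G (K \ S) C → Small G N C) : Small G N K

theorem IsComp.nbr_subset {K S C : Set V} (hC : IsComp G (K \ S) C) :
    nbr G C ⊆ nbr G K ∪ (S ∩ K) := by
  rintro v ⟨hvC, u, hu, huv⟩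
  by_cases hvK : v ∈ K
  · by_cases hvS : v ∈ S
    · exact .inr ⟨hvS, hvK⟩
    · exact absurd (hC.closed u hu v ⟨hvK, hvS⟩ huv) hvC
  · exact .inl ⟨hvK, u, (hC.sub hu).1, huv⟩

/-- A rooted tree decomposition, with bags of size at most `N`, of the graph formed by the edges
meeting `K`, in which the neighbourhood of `K` lies in the root bag. The tree is given by a parent
function on the index type. -/
structure RootedDecomp (G : SimpleGraph V) (N : ℕ) (K : Set V) (ι : Type*) where
  root : ι
  par : ι → ι
  depth : ι → ℕ
  bag : ι → Set V
  depth_par : ∀ i, i ≠ root → depth (par i) < depth i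
  nbr_subset : nbr G K ⊆ bag root
  bag_subset : ∀ i, bag i ⊆ K ∪ nbr G K
  card_le : ∀ i, (bag i).ncard ≤ N
  mem_bag : ∀ v ∈ K, ∃ i, v ∈ bag i
  adj_bag : ∀ u ∈ K, ∀ v, G.Adj u v → ∃ i, u ∈ bag i ∧ v ∈ bag i
  top : V → ι
  mem_par : ∀ v i, v ∈ bag i → i ≠ top v → i ≠ root ∧ v ∈ bag (par i)

/-- Transport of a decomposition along an equivalence of index types. -/
def RootedDecomp.congr {N : ℕ} {K : Set V} {ι κ : Type*} (D : RootedDecomp G N K ι) (e : ι ≃ κ) :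
    RootedDecomp G N K κ where
  root := e D.root
  par i := e (D.par (e.symm i))
  depth i := D.depth (e.symm i)
  bag i := D.bag (e.symm i)
  depth_par i hi := by
    simpa using D.depth_par (e.symm i) (fun h => hi (by simp [← h]))
  nbr_subset := by simpa using D.nbr_subset
  bag_subset i := D.bag_subset _
  card_le i := D.card_le _
  mem_bag v hv := by
    obtain ⟨i, hi⟩ := D.mem_bag v hv
    exact ⟨e i, by simpa using hi⟩
  adj_bag u hu v huv := by
    obtain ⟨i, hi⟩ := D.adj_bag u hu v huv
    exact ⟨e i, by simpa using hi⟩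
  top v := e (D.top v)
  mem_par v i hv hi := by
    have := D.mem_par v (e.symm i) hv (fun h => hi (by simp [← h]))
    exact ⟨fun h => this.1 (by simp [h]), by simpa using this.2⟩

open Classical in
theorem exists_rootedDecomp_of_comps {V : Type*} [Finite V] {G : SimpleGraph V} {N : ℕ}
    {K S : Set V} (hcard : (nbr G K ∪ S).ncard ≤ N)
    (ι : {C // IsComp G (K \ S) C} → Type*) (D : ∀ C, RootedDecomp G N C.1 (ι C)) :
    Nonempty (RootedDecomp G N K (Option (Σ C, ι C))) := by
  have hcomp : ∀ v, v ∈ K \ S → ∃ C : {C // IsComp G (K \ S) C}, v ∈ C.1 := fun v hv => by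
    obtain ⟨C, hC, hvC⟩ := exists_isComp G hv
    exact ⟨⟨C, hC⟩, hvC⟩
  choose comp hcomp using hcomp
  refine ⟨{
    root := none
    par := fun i => i.elim none fun p =>
      if p.2 = (D p.1).root then none else some ⟨p.1, (D p.1).par p.2⟩
    depth := fun i => i.elim 0 fun p => (D p.1).depth p.2 + 1
    bag := fun i => i.elim (nbr G K ∪ (S ∩ K)) fun p => (D p.1).bag p.2
    top := fun v => if h : v ∈ K \ S then some ⟨comp v h, (D (comp v h)).top v⟩ else none
    depth_par := ?_
    nbr_subset := Set.subset_union_left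
    bag_subset := ?_
    card_le := ?_
    mem_bag := ?_
    adj_bag := ?_
    mem_par := ?_ }⟩
  · rintro (_ | ⟨C, i⟩) hi
    · exact absurd rfl hi
    · by_cases h : i = (D C).root
      · simp [h]
      · simpa [h] using (D C).depth_par i h
  · rintro (_ | ⟨C, i⟩)
    · exact Set.union_subset Set.subset_union_right
        (Set.inter_subset_right.trans Set.subset_union_left)
    · intro v hv
      rcases (D C).bag_subset i hv with h | h
      · exact .inl (C.2.sub h).1
      · rcases C.2.nbr_subset h with h | h
        · exact .inr h
        · exact .inl h.2
  · rintro (_ | ⟨C, i⟩)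
    · exact (Set.ncard_le_ncard (Set.union_subset_union_right _ Set.inter_subset_left)
        (Set.toFinite _)).trans hcard
    · exact (D C).card_le i
  · intro v hv
    by_cases hvS : v ∈ S
    · exact ⟨none, .inr ⟨hvS, hv⟩⟩
    · obtain ⟨i, hi⟩ := (D (comp v ⟨hv, hvS⟩)).mem_bag v (hcomp v ⟨hv, hvS⟩)
      exact ⟨some ⟨_, i⟩, hi⟩
  · intro u hu v huv
    by_cases huS : u ∈ S
    · by_cases hvK : v ∈ K
      · by_cases hvS : v ∈ S
        · exact ⟨none, .inr ⟨huS, hu⟩, .inr ⟨hvS, hvK⟩⟩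
        · obtain ⟨i, hi⟩ := (D (comp v ⟨hvK, hvS⟩)).adj_bag v (hcomp v ⟨hvK, hvS⟩) u huv.symm
          exact ⟨some ⟨_, i⟩, hi.2, hi.1⟩
      · exact ⟨none, .inr ⟨huS, hu⟩, .inl ⟨hvK, u, hu, huv⟩⟩
    · obtain ⟨i, hi⟩ := (D (comp u ⟨hu, huS⟩)).adj_bag u (hcomp u ⟨hu, huS⟩) v huv
      exact ⟨some ⟨_, i⟩, hi⟩
  · rintro v (_ | ⟨C, i⟩) hv hi
    · have h : ¬ v ∈ K \ S := by
        rcases hv with hv | hv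
        · exact fun h => hv.1 h.1
        · exact fun h => h.2 hv.1
      simp [h] at hi
    · refine ⟨by simp, ?_⟩
      simp only [Option.elim_some] at hv ⊢
      by_cases hvC : v ∈ C.1
      · have h := C.2.sub hvC
        have hC : C = comp v h := Subtype.ext (C.2.eq_of_mem (comp v h).2 hvC (hcomp v h))
        subst hC
        rw [dif_pos h] at hi
        have := (D _).mem_par v i hv (fun h => hi (by rw [← h]))
        simpa [this.1] using this.2
      · have hvn : v ∈ nbr G C.1 := ((D C).bag_subset i hv).resolve_left hvC
        by_cases h : i = (D C).root
        · simpa [h] using C.2.nbr_subset hvn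
        · have htop : (D C).root = (D C).top v := by
            by_contra hne
            exact ((D C).mem_par v _ ((D C).nbr_subset hvn) hne).1 rfl
          simpa [h] using ((D C).mem_par v i hv (htop ▸ h)).2

theorem Small.exists_rootedDecomp {V : Type*} [Finite V] {G : SimpleGraph V} {N : ℕ} {K : Set V}
    (h : Small G N K) : ∃ n, Nonempty (RootedDecomp G N K (Fin n)) := by
  induction h with
  | mk K S hcard _ ih =>
    choose n hn using ih
    obtain ⟨D⟩ := exists_rootedDecomp_of_comps hcard (fun C => Fin (n C.1 C.2))
      fun C => (hn C.1 C.2).some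
    exact ⟨_, ⟨D.congr (Finite.equivFin _)⟩⟩

namespace RootedDecomp

variable {N : ℕ} {K : Set V} {ι : Type*} (D : RootedDecomp G N K ι)

/-- The tree of a rooted decomposition. -/
def tree : SimpleGraph ι where
  Adj i j := (i ≠ D.root ∧ D.par i = j) ∨ (j ≠ D.root ∧ D.par j = i)
  symm := ⟨fun _ _ h => h.symm⟩
  loopless := ⟨fun i h => by
    have : i ≠ D.root ∧ D.par i = i := h.elim id id
    exact (D.depth_par i this.1).ne (by rw [this.2])⟩

theorem isTree_tree [Finite ι] : D.tree.IsTree := by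
  have hreach : ∀ n i, D.depth i = n → D.tree.Reachable i D.root := by
    intro n
    induction n using Nat.strong_induction_on with
    | _ n ih =>
      rintro i rfl
      by_cases hi : i = D.root
      · rw [hi]
      · exact (Adj.reachable (G := D.tree) (.inl ⟨hi, rfl⟩)).trans
          (ih _ (D.depth_par i hi) (D.par i) rfl)
  have hconn : D.tree.Connected :=
    (connected_iff_exists_forall_reachable _).2 ⟨D.root, fun i => (hreach _ i rfl).symm⟩
  refine isTree_iff_connected_and_card.2 ⟨hconn, le_antisymm ?_
    hconn.card_vert_le_card_edgeSet_add_one⟩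
  have hsurj : Function.Surjective (fun i : ({D.root}ᶜ : Set ι) =>
      (⟨s(i.1, D.par i.1), .inl ⟨i.2, rfl⟩⟩ : D.tree.edgeSet)) := by
    rintro ⟨e, he⟩
    induction e with
    | _ i j =>
      rcases he with ⟨hi, h⟩ | ⟨hj, h⟩
      · exact ⟨⟨i, hi⟩, Subtype.ext (congrArg (fun j => s(i, j)) h)⟩
      · exact ⟨⟨j, hj⟩, Subtype.ext ((congrArg (fun i => s(j, i)) h).trans Sym2.eq_swap)⟩
  have h1 : Nat.card D.tree.edgeSet ≤ Nat.card ({D.root}ᶜ : Set ι) :=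
    Nat.card_le_card_of_surjective _ hsurj
  have h2 : ({D.root}ᶜ : Set ι).ncard + ({D.root} : Set ι).ncard = Nat.card ι := by
    rw [add_comm]
    exact Set.ncard_add_ncard_compl _
  rw [Set.ncard_singleton] at h2
  rw [Nat.card_coe_set_eq ({D.root}ᶜ : Set ι)] at h1
  omega

theorem induce_tree_connected {v : V} {i : ι} (hi : v ∈ D.bag i) :
    (D.tree.induce {i | v ∈ D.bag i}).Connected := by
  have key : ∀ n i (hi : v ∈ D.bag i), D.depth i = n → ∃ ht : v ∈ D.bag (D.top v),
      (D.tree.induce {i | v ∈ D.bag i}).Reachable ⟨D.top v, ht⟩ ⟨i, hi⟩ := by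
    intro n
    induction n using Nat.strong_induction_on with
    | _ n ih =>
      rintro i hi rfl
      by_cases hit : i = D.top v
      · subst hit
        exact ⟨hi, .refl _⟩
      · obtain ⟨hr, hp⟩ := D.mem_par v i hi hit
        obtain ⟨ht, h⟩ := ih _ (D.depth_par i hr) _ hp rfl
        refine ⟨ht, h.trans (Adj.reachable ?_)⟩
        exact Or.inr ⟨hr, rfl⟩
  obtain ⟨ht, -⟩ := key _ i hi rfl
  exact (connected_iff_exists_forall_reachable _).2
    ⟨⟨_, ht⟩, fun j => (key _ j.1 j.2 rfl).2⟩

end RootedDecomp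

theorem treewidth_le_of_small {V : Type*} [Fintype V] {G : SimpleGraph V} {w : ℕ}
    (h : Small G (w + 1) Set.univ) : treewidth G ≤ w := by
  classical
  obtain ⟨n, ⟨D⟩⟩ := h.exists_rootedDecomp
  refine Nat.sInf_le ⟨Fin n, inferInstance, D.tree, fun i => (D.bag i).toFinset, D.isTree_tree,
    fun v => ?_, fun u v huv => ?_, fun v => ?_, fun i => ?_⟩
  · simpa using D.mem_bag v trivial
  · simpa using D.adj_bag u trivial v huv
  · obtain ⟨i, hi⟩ := D.mem_bag v trivial
    have h : {i | v ∈ (D.bag i).toFinset} = {i | v ∈ D.bag i} := by ext; simp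
    rw [h]
    exact D.induce_tree_connected hi
  · simpa [Set.ncard_eq_toFinset_card'] using D.card_le i

/-! ### Path models rooted at the neighbourhood of a set -/

/-- Disjoint connected sets `M 0, …, M (n - 1)`, with consecutive ones adjacent. -/
structure PathModel (G : SimpleGraph V) (M : ℕ → Set V) (n : ℕ) : Prop where
  conn : ∀ i < n, Conn G (M i)
  eq_of_mem : ∀ i < n, ∀ j < n, ∀ v ∈ M i, v ∈ M j → i = j
  adj : ∀ i, i + 1 < n → ∃ a ∈ M i, ∃ b ∈ M (i + 1), G.Adj a b

/-- A path model outside `K` covering the neighbours of `K`, each set having at most one of them. -/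
structure RootedModel (G : SimpleGraph V) (K : Set V) (M : ℕ → Set V) (n : ℕ) : Prop
    extends PathModel G M n where
  notMem : ∀ i < n, ∀ v ∈ M i, v ∉ K
  mem_of_nbr : ∀ v ∈ nbr G K, ∃ i < n, v ∈ M i
  unique : ∀ i < n, ∀ u ∈ M i, ∀ v ∈ M i, u ∈ nbr G K → v ∈ nbr G K → u = v

theorem RootedModel.extend {K : Set V} {M : ℕ → Set V} {n : ℕ} (h : RootedModel G K M n)
    (hK : K.Nonempty) :
    ∃ v ∈ K, ∀ C, IsComp G (K \ {v}) C → ∃ M' n', RootedModel G C M' n' := by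
  classical
  have hex : ∃ m, ∀ z ∈ nbr G K, ∃ i < m, i < n ∧ z ∈ M i := ⟨n, fun z hz => by
    obtain ⟨i, hi, hz⟩ := h.mem_of_nbr z hz
    exact ⟨i, hi, hi, hz⟩⟩
  have hm := Nat.find_spec hex
  have hmin := fun m' => Nat.find_min hex (m := m')
  generalize Nat.find hex = m at hm hmin
  have hmn : m ≤ n := by
    by_contra! hlt
    exact hmin n hlt fun z hz => by
      obtain ⟨i, -, hi, hz⟩ := hm z hz
      exact ⟨i, hi, hi, hz⟩
  obtain ⟨v, hv, hlast⟩ : ∃ v ∈ K, ∀ i, i + 1 = m → ∃ a ∈ M i, G.Adj a v := by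
    rcases m with _ | p
    · obtain ⟨v, hv⟩ := hK
      exact ⟨v, hv, by simp⟩
    · obtain ⟨z, hz, hzp⟩ : ∃ z ∈ nbr G K, ¬ ∃ i < p, i < n ∧ z ∈ M i := by
        have := hmin p (by omega)
        push Not at this ⊢
        exact this
      obtain ⟨i, hip, hin, hzi⟩ := hm z hz
      obtain ⟨-, v, hv, hvz⟩ := id hz
      refine ⟨v, hv, fun j hj => ⟨z, ?_, hvz.symm⟩⟩
      have : i = j := by
        by_contra hne
        exact hzp ⟨i, by omega, hin, hzi⟩
      exact this ▸ hzi
  refine ⟨v, hv, fun C hC => ⟨fun i => if i < m then M i else {v}, m + 1, ?_⟩⟩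
  have hsub : ∀ z ∈ nbr G C, z ∈ nbr G K ∨ z = v := fun z hz =>
    (hC.nbr_subset hz).imp_right fun h => h.1
  have hvM : ∀ i < m, v ∉ M i := fun i hi hvi => h.notMem i (by omega) v hvi hv
  refine ⟨⟨fun i hi => ?_, fun i hi j hj u hu hu' => ?_, fun i hi => ?_⟩, fun i hi u hu => ?_,
    fun u hu => ?_, fun i hi a ha b hb ha' hb' => ?_⟩
  · by_cases him : i < m
    · simpa [him] using h.conn i (by omega)
    · simpa [him] using conn_singleton v
  · by_cases him : i < m <;> by_cases hjm : j < m <;>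
      simp only [him, hjm, if_true, if_false] at hu hu'
    · exact h.eq_of_mem i (by omega) j (by omega) u hu hu'
    · exact absurd (hu' ▸ hu) (hvM i him)
    · exact absurd (hu ▸ hu') (hvM j hjm)
    · omega
  · have him : i < m := by omega
    by_cases him' : i + 1 < m
    · simpa [him, him'] using h.adj i (by omega)
    · simpa [him, him'] using hlast i (by omega)
  · by_cases him : i < m <;> simp only [him, if_true, if_false] at hu
    · exact fun huC => h.notMem i (by omega) u hu (hC.sub huC).1
    · exact fun huC => (hC.sub huC).2 hu
  · rcases hsub u hu with hu | rfl
    · obtain ⟨i, him, -, hui⟩ := hm u hu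
      exact ⟨i, by omega, by simpa [him] using hui⟩
    · exact ⟨m, by omega, by simp⟩
  · by_cases him : i < m <;> simp only [him, if_true, if_false] at ha hb
    · refine h.unique i (by omega) a ha b hb ?_ ?_
      · exact (hsub a ha').resolve_right fun h => hvM i him (h ▸ ha)
      · exact (hsub b hb').resolve_right fun h => hvM i him (h ▸ hb)
    · exact ha.trans hb.symm

/-- The edges of `G` with at least one end in `K`. -/
def edgesAt (G : SimpleGraph V) (K : Set V) : SimpleGraph V where
  Adj u v := G.Adj u v ∧ (u ∈ K ∨ v ∈ K)
  symm := ⟨fun _ _ h => ⟨h.1.symm, h.2.symm⟩⟩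
  loopless := ⟨fun _ h => h.1.ne rfl⟩

theorem edgesAt_le (G : SimpleGraph V) (K : Set V) : edgesAt G K ≤ G := fun _ _ h => h.1

theorem mem_of_edgesAt {K : Set V} {u v : V} (h : (edgesAt G K).Adj u v) : v ∈ K ∪ nbr G K := by
  by_cases hv : v ∈ K
  · exact .inl hv
  · exact .inr ⟨hv, u, h.2.resolve_right hv, h.1⟩

theorem nbr_subset_of_isSep {K X Y A B C : Set V} (hXY : X ∪ Y = nbr G K)
    (hs : IsSep (edgesAt G K) X Y A B) (hC : IsComp G (K \ (A ∩ B)) C) (hCB : Disjoint C B) :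
    nbr G C ⊆ X ∪ (A ∩ B) := by
  intro v hv
  obtain ⟨hvC, u, huC, huv⟩ := id hv
  have huB : u ∉ B := Set.disjoint_left.1 hCB huC
  have hvA : v ∈ A := hs.adj u v ⟨huv, .inl (hC.sub huC).1⟩ ((hs.cover u).resolve_right huB) huB
  rcases hC.nbr_subset hv with h | h
  · rw [← hXY] at h
    exact h.imp_right fun h => ⟨hvA, hs.right h⟩
  · exact .inr h.1

/-- A rooted model can be transferred along a minimum separation of `K` to a component on the `X`
side, using linking sets on the `Y` side. -/
theorem RootedModel.transfer [Finite V] {K X Y A B C : Set V} {M : ℕ → Set V} {n : ℕ}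
    (h : RootedModel G K M n) (hXY : X ∪ Y = nbr G K)
    (hs : IsSep (edgesAt G K) X Y A B)
    (hmin : ∀ A' B', IsSep (edgesAt G K) X Y A' B' → (A ∩ B).ncard ≤ (A' ∩ B').ncard)
    (hC : IsComp G (K \ (A ∩ B)) C) (hCB : Disjoint C B) : ∃ M', RootedModel G C M' n := by
  have hXK : X ⊆ nbr G K := hXY ▸ Set.subset_union_left
  have hYK : Y ⊆ nbr G K := hXY ▸ Set.subset_union_right
  have hCX := nbr_subset_of_isSep hXY hs hC hCB
  obtain ⟨P, hPc, hPd, hPY, hPS⟩ : Linked (within (edgesAt G K) B) Y (A ∩ B) (A ∩ B).ncard := by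
    refine menger _ _ _ _ fun A' B' h' => ?_
    refine le_ncard_of_isSep_within (B := X) (D := A) (C := B)
      (fun C D hCD => Set.inter_comm D C ▸ hmin D C hCD.symm) hs.right hs.left
      (fun v => (hs.cover v).symm) (fun u v huv hu hu' hv => ?_) (Set.inter_comm A B).ge h'
    exact absurd (hs.symm.adj u v huv hu hu') hv
  have hPB : ∀ i, P i ⊆ B ∩ (K ∪ nbr G K) := fun i => by
    obtain ⟨y, hy⟩ := hPY i
    have hy : y ∈ P i ∩ Y := hy ▸ rfl
    exact (hPc i).subset_of_adj hy.1 ⟨hs.right hy.2, .inr (hYK hy.2)⟩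
      fun u v huv => ⟨huv.2.2, mem_of_edgesAt huv.1⟩
  have hPeq : ∀ {i i' v}, v ∈ P i → v ∈ P i' → i = i' := fun {i i' v} hv hv' => by
    by_contra hne
    exact Set.disjoint_left.1 (hPd hne) hv hv'
  have hMK : ∀ {j v}, j < n → v ∈ M j → v ∈ K ∪ nbr G K → v ∈ nbr G K := fun hj hv h' =>
    h'.resolve_left (h.notMem _ hj _ hv)
  let Good (i : Fin (A ∩ B).ncard) (j : ℕ) : Prop :=
    (∀ s ∈ P i, s ∈ A ∩ B → s ∉ X) ∧ ∃ y ∈ P i, y ∈ Y ∧ y ∈ M j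
  have hgood : ∀ {i j j' v}, Good i j → v ∈ P i → j < n → j' < n → v ∈ M j' → j' = j := by
    rintro i j j' v ⟨hiX, y, hyP, hyY, hyM⟩ hv hj hj' hvM
    have hvK := hMK hj' hvM (hPB i hv).2
    rw [← hXY] at hvK
    rcases hvK with hvX | hvY
    · exact absurd hvX (hiX v hv ⟨hs.left hvX, (hPB i hv).1⟩)
    · rw [eq_of_inter_eq_singleton (hPY i) hv hvY hyP hyY] at hvM
      exact h.eq_of_mem _ hj' _ hj y hvM hyM
  have hCK : nbr G C ⊆ K ∪ nbr G K := hC.nbr_subset.trans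
    (Set.union_subset Set.subset_union_right (Set.inter_subset_right.trans Set.subset_union_left))
  have hPC : ∀ {i v}, v ∈ P i → v ∈ nbr G C → v ∈ A ∩ B := fun {i v} hv hvC =>
    (hCX hvC).elim (fun hX => ⟨hs.left hX, (hPB i hv).1⟩) id
  refine ⟨fun j => {v | v ∈ M j ∨ ∃ i, v ∈ P i ∧ Good i j}, ⟨⟨fun j hj => ?_, ?_, fun j hj => ?_⟩,
    ?_, fun v hv => ?_, ?_⟩⟩
  · obtain ⟨r, hr⟩ := (h.conn j hj).1
    have := conn_sUnion (G := G) (r := r)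
      (S := insert (M j) {L | ∃ i, Good i j ∧ L = M j ∪ P i}) ⟨M j, .inl rfl⟩ (by
        rintro L (rfl | ⟨i, ⟨hi, y, hyP, -, hyM⟩, rfl⟩)
        · exact h.conn j hj
        · exact (h.conn j hj).union_of_mem
            ((hPc i).mono ((within_le _ _).trans (edgesAt_le _ _))) hyM hyP) (by
        rintro L (rfl | ⟨i, -, rfl⟩)
        · exact hr
        · exact .inl hr)
    convert this using 1
    ext v
    constructor
    · rintro (hv | ⟨i, hv, hi⟩)
      · exact ⟨M j, .inl rfl, hv⟩
      · exact ⟨_, .inr ⟨i, hi, rfl⟩, .inr hv⟩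
    · rintro ⟨L, (rfl | ⟨i, hi, rfl⟩), hv⟩
      · exact .inl hv
      · exact hv.imp_right fun hv => ⟨i, hv, hi⟩
  · rintro j hj j' hj' v (hv | ⟨i, hv, hi⟩) (hv' | ⟨i', hv', hi'⟩)
    · exact h.eq_of_mem j hj j' hj' v hv hv'
    · exact hgood hi' hv' hj' hj hv
    · exact (hgood hi hv hj hj' hv').symm
    · obtain rfl := hPeq hv hv'
      obtain ⟨-, y, hyP, -, hyM⟩ := hi'
      exact (hgood hi hyP hj hj' hyM).symm
  · obtain ⟨a, ha, b, hb, hab⟩ := h.adj j hj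
    exact ⟨a, .inl ha, b, .inl hb, hab⟩
  · rintro j hj v (hv | ⟨i, hv, -⟩) hvC
    · exact h.notMem j hj v hv (hC.sub hvC).1
    · exact Set.disjoint_left.1 hCB hvC (hPB i hv).1
  · by_cases hvX : v ∈ X
    · obtain ⟨j, hj, hvj⟩ := h.mem_of_nbr v (hXK hvX)
      exact ⟨j, hj, .inl hvj⟩
    · have hvS := (hCX hv).resolve_left hvX
      obtain ⟨i, hi⟩ := exists_mem_of_unique le_rfl hPd hPS hvS
      obtain ⟨y, hy⟩ := hPY i
      have hy : y ∈ P i ∩ Y := hy ▸ rfl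
      obtain ⟨j, hj, hyj⟩ := h.mem_of_nbr y (hYK hy.2)
      refine ⟨j, hj, .inr ⟨i, hi, fun s hs hsS => ?_, y, hy.1, hy.2, hyj⟩⟩
      rwa [eq_of_inter_eq_singleton (hPS i) hs hsS hi hvS]
  · have mixed : ∀ {i j u v}, j < n → Good i j → u ∈ P i → v ∈ M j → u ∈ nbr G C → v ∈ nbr G C →
        u = v := by
      rintro i j u v hj ⟨-, y, hyP, hyY, hyM⟩ hu hv huC hvC
      obtain rfl := h.unique j hj v hv y hyM (hMK hj hv (hCK hvC)) (hYK hyY)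
      exact eq_of_inter_eq_singleton (hPS i) hu (hPC hu huC) hyP (hPC hyP hvC)
    rintro j hj u (hu | ⟨i, hu, hi⟩) v (hv | ⟨i', hv, hi'⟩) huC hvC
    · exact h.unique j hj u hu v hv (hMK hj hu (hCK huC)) (hMK hj hv (hCK hvC))
    · exact (mixed hj hi' hv hu hvC huC).symm
    · exact mixed hj hi hu hv huC hvC
    · obtain ⟨-, y, hyP, hyY, hyM⟩ := hi
      obtain ⟨-, y', hyP', hyY', hyM'⟩ := hi'
      obtain rfl := h.unique j hj y hyM y' hyM' (hYK hyY) (hYK hyY')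
      obtain rfl := hPeq hyP hyP'
      exact eq_of_inter_eq_singleton (hPS i) hu (hPC hu huC) hv (hPC hv hvC)

theorem exists_comp_not_small {N : ℕ} {K S : Set V} (hK : ¬ Small G N K)
    (hcard : (nbr G K ∪ S).ncard ≤ N) : ∃ C, IsComp G (K \ S) C ∧ ¬ Small G N C := by
  by_contra! hc
  exact hK (.mk K S hcard hc)

/-- If `G` cannot be recursively separated by sets of size `N ≥ 3 s - 1`, then it has a connected
set `K` with `2 s` neighbours, a path model rooted at them, and linkages through `K` between any two
halves of them. -/
theorem exists_rooted_linked [Finite V] {N s : ℕ} (hN : 3 * s ≤ N + 1)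
    (hG : ¬ Small G N Set.univ) :
    ∃ K M n, Conn G K ∧ RootedModel G K M n ∧ (nbr G K).ncard = 2 * s ∧
      ∀ X Y, X ∪ Y = nbr G K → X.ncard = s → Y.ncard = s →
        Linked (edgesAt G K) X Y s := by
  let State (K : Set V) : Prop := Conn G K ∧ ¬ Small G N K ∧ (nbr G K).ncard ≤ 2 * s ∧
    ∃ M n, RootedModel G K M n
  have hne : {K | State K}.Nonempty := by
    have huniv : nbr G (Set.univ : Set V) = ∅ := by
      ext v
      simp [nbr]
    obtain ⟨C, hC, hCs⟩ := exists_comp_not_small (S := ∅) hG (by simp [huniv])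
    have hCn : nbr G C = ∅ := by
      refine Set.subset_empty_iff.1 (hC.nbr_subset.trans ?_)
      simp [huniv]
    exact ⟨C, hC.conn, hCs, by simp [hCn], fun _ => ∅, 0, 
      ⟨⟨by simp, by simp, by simp⟩, by simp, by simp [hCn], by simp⟩⟩
  obtain ⟨K, ⟨hKc, hKs, hKn, M, n, hM⟩, hmin⟩ := (Set.toFinite {K | State K}).exists_minimal hne
  have hno : ∀ C ⊆ K, C ≠ K → ¬ State C := fun C hCK hne h =>
    hne (hCK.antisymm (hmin h hCK))
  have hcard : (nbr G K).ncard = 2 * s := by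
    by_contra hcard
    obtain ⟨v, hv, hext⟩ := hM.extend hKc.1
    have hle : (nbr G K ∪ {v}).ncard ≤ 2 * s := by
      have := Set.ncard_union_le (nbr G K) {v}
      rw [Set.ncard_singleton] at this
      omega
    obtain ⟨C, hC, hCs⟩ := exists_comp_not_small (S := {v}) hKs (by omega)
    refine hno C (hC.sub.trans Set.sdiff_subset) (fun h => (hC.sub (h ▸ hv)).2 rfl)
      ⟨hC.conn, hCs, (Set.ncard_le_ncard ?_ (Set.toFinite _)).trans hle, hext C hC⟩
    exact hC.nbr_subset.trans (Set.union_subset_union_right _ Set.inter_subset_left)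
  refine ⟨K, M, n, hKc, hM, hcard, fun X Y hXY hX hY => menger _ _ _ _ ?_⟩
  by_contra! hsep
  obtain ⟨A₀, B₀, hs₀, hlt₀⟩ := hsep
  obtain ⟨⟨A, B⟩, hAB, hABmin⟩ := Set.exists_min_image
    {p : Set V × Set V | IsSep (edgesAt G K) X Y p.1 p.2} (fun p => (p.1 ∩ p.2).ncard)
    (Set.toFinite _) ⟨(A₀, B₀), hs₀⟩
  have hlt : (A ∩ B).ncard < s := (hABmin (A₀, B₀) hs₀).trans_lt hlt₀
  have hle : (nbr G K ∪ A ∩ B).ncard ≤ N := by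
    have := Set.ncard_union_le (nbr G K) (A ∩ B)
    omega
  obtain ⟨C, hC, hCs⟩ := exists_comp_not_small hKs hle
  have finish : ∀ {X Y A B}, X ∪ Y = nbr G K → X.ncard = s →
      IsSep (edgesAt G K) X Y A B → (A ∩ B).ncard < s →
      (∀ A' B', IsSep (edgesAt G K) X Y A' B' → (A ∩ B).ncard ≤ (A' ∩ B').ncard) →
      IsComp G (K \ (A ∩ B)) C → ¬ Disjoint C B := by
    intro X Y A B hXY hX hAB hlt hmin hC hCB
    have hnlt : (nbr G C).ncard < 2 * s := by
      have h1 := Set.ncard_le_ncard (nbr_subset_of_isSep hXY hAB hC hCB) (Set.toFinite _)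
      have h2 := Set.ncard_union_le X (A ∩ B)
      omega
    obtain ⟨M', hM'⟩ := hM.transfer hXY hAB hmin hC hCB
    exact hno C (hC.sub.trans Set.sdiff_subset) (fun h => by rw [h] at hnlt; omega)
      ⟨hC.conn, hCs, hnlt.le, M', n, hM'⟩
  have hCAB : ∀ v ∈ C, ¬ (v ∈ A ∧ v ∈ B) := fun v hv h => (hC.sub hv).2 h
  obtain ⟨b, hb, hbB⟩ := Set.not_disjoint_iff.1
    (finish hXY hX hAB hlt (fun A' B' h => hABmin (A', B') h) hC)
  obtain ⟨a, ha, haA⟩ := Set.not_disjoint_iff.1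
    (finish ((Set.union_comm Y X).trans hXY) hY hAB.symm (Set.inter_comm A B ▸ hlt)
      (fun A' B' h => by
        rw [Set.inter_comm B A, Set.inter_comm A' B']
        exact hABmin (B', A') h.symm) (Set.inter_comm A B ▸ hC))
  obtain ⟨u, huC, huA, v, hvC, hvA, huv⟩ := hC.conn.exists_adj (U := A) ⟨a, ha, haA⟩
    ⟨b, hb, fun h => hCAB b hb ⟨h, hbB⟩⟩
  exact hvA (hAB.adj u v ⟨huv, .inl (hC.sub huC).1⟩ huA fun h => hCAB u huC ⟨huA, h⟩)

/-! ### Monotone sequences -/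

/-- A set of more than `a * b` points of the plane with distinct first and distinct second
coordinates contains an increasing sequence of length `a + 1` or a decreasing one of length
`b + 1`. -/
theorem erdos_szekeres {ι : Type*} {p r : ι → ℕ} (a b : ℕ) (J : Finset ι)
    (hp : Set.InjOn p J) (hr : Set.InjOn r J) (hJ : a * b < J.card) :
    (∃ c : ℕ → ι, (∀ i ≤ a, c i ∈ J) ∧ ∀ i < a, p (c i) < p (c (i + 1)) ∧ r (c i) < r (c (i + 1))) ∨
    ∃ c : ℕ → ι, (∀ i ≤ b, c i ∈ J) ∧
      ∀ i < b, p (c i) < p (c (i + 1)) ∧ r (c (i + 1)) < r (c i) := by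
  classical
  induction a generalizing J with
  | zero =>
    obtain ⟨j, hj⟩ : J.Nonempty := Finset.card_pos.1 (by omega)
    exact .inl ⟨fun _ => j, fun _ _ => hj, by simp⟩
  | succ a ih =>
    let J' := J.filter fun j => ∃ i ∈ J, p i < p j ∧ r i < r j
    have hJ' : J' ⊆ J := Finset.filter_subset _ _
    by_cases h : a * b < J'.card
    · rcases ih J' (hp.mono hJ') (hr.mono hJ') h with ⟨c, hc, hlt⟩ | ⟨c, hc, hlt⟩
      · obtain ⟨-, i, hi, hi'⟩ := Finset.mem_filter.1 (hc 0 (Nat.zero_le _))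
        refine .inl ⟨fun m => m.casesOn i c, fun m hm => ?_, fun m hm => ?_⟩
        · cases m with
          | zero => exact hi
          | succ m => exact hJ' (hc m (by omega))
        · cases m with
          | zero => exact hi'
          | succ m => exact hlt m (by omega)
      · exact .inr ⟨c, fun i hi => hJ' (hc i hi), hlt⟩
    · have hcard : b + 1 ≤ ((J \ J').image p).card := by
        rw [Finset.card_image_of_injOn (hp.mono (by simp)), Finset.card_sdiff_of_subset hJ']
        have : (a + 1) * b = a * b + b := by ring
        omega
      let e := Finset.orderEmbOfCardLe _ hcard
      have he : ∀ i, ∃ j ∈ J \ J', p j = e i := fun i =>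
        Finset.mem_image.1 (Finset.orderEmbOfCardLe_mem _ hcard i)
      choose c hc hce using he
      refine .inr ⟨fun i => c (Fin.ofNat (b + 1) i), fun i _ => (Finset.mem_sdiff.1 (hc _)).1,
        fun i hi => ?_⟩
      have hlt : p (c (Fin.ofNat (b + 1) i)) < p (c (Fin.ofNat (b + 1) (i + 1))) := by
        rw [hce, hce]
        refine e.strictMono (Fin.lt_def.2 ?_)
        simp only [Fin.ofNat]
        rw [Nat.mod_eq_of_lt (by omega), Nat.mod_eq_of_lt (by omega)]
        omega
      refine ⟨hlt, lt_of_le_of_ne (not_lt.1 fun h => ?_) fun h => ?_⟩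
      · have h1 := Finset.mem_sdiff.1 (hc (Fin.ofNat (b + 1) i))
        have h2 := Finset.mem_sdiff.1 (hc (Fin.ofNat (b + 1) (i + 1)))
        exact h2.2 (Finset.mem_filter.2 ⟨h2.1, _, h1.1, hlt, h⟩)
      · rw [hr (Finset.mem_sdiff.1 (hc _)).1 (Finset.mem_sdiff.1 (hc _)).1 h] at hlt
        exact lt_irrefl _ hlt

/-! ### Yurts from two path models -/

theorem PathModel.take {M : ℕ → Set V} {m n : ℕ} (h : PathModel G M n) (hmn : m ≤ n) :
    PathModel G M m where
  conn i hi := h.conn i (by omega)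
  eq_of_mem i hi j hj := h.eq_of_mem i (by omega) j (by omega)
  adj i hi := h.adj i (by omega)

theorem PathModel.reverse {M : ℕ → Set V} {n : ℕ} (h : PathModel G M n) :
    PathModel G (fun i => M (n - 1 - i)) n where
  conn i hi := h.conn _ (by omega)
  eq_of_mem i hi j hj v hv hv' := by
    have := h.eq_of_mem _ (by omega) _ (by omega) v hv hv'
    omega
  adj i hi := by
    obtain ⟨a, ha, b, hb, hab⟩ := h.adj (n - 1 - (i + 1)) (by omega)
    rw [show n - 1 - (i + 1) + 1 = n - 1 - i by omega] at hb
    exact ⟨b, hb, a, ha, hab.symm⟩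

/-- The union of the sets `M j` with `a ≤ j < b`. -/
def segment (M : ℕ → Set V) (a b : ℕ) : Set V := {v | ∃ j, a ≤ j ∧ j < b ∧ v ∈ M j}

theorem PathModel.conn_segment {M : ℕ → Set V} {n a b : ℕ} (h : PathModel G M n) (hab : a < b)
    (hbn : b ≤ n) : Conn G (segment M a b) := by
  induction b, hab using Nat.le_induction with
  | base =>
    convert h.conn a (by omega) using 1
    ext v
    constructor
    · rintro ⟨j, hj, hj', hv⟩
      rwa [show a = j by omega]
    · exact fun hv => ⟨a, le_rfl, by omega, hv⟩
  | succ b hab ih =>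
    obtain ⟨x, hx, y, hy, hxy⟩ := h.adj (b - 1) (by omega)
    rw [show b - 1 + 1 = b by omega] at hy
    convert (ih (by omega)).union_of_adj (h.conn b (by omega)) ⟨b - 1, by omega, by omega, hx⟩ hy
      hxy using 1
    ext v
    constructor
    · rintro ⟨j, hj, hj', hv⟩
      by_cases hjb : j = b
      · exact .inr (hjb ▸ hv)
      · exact .inl ⟨j, hj, by omega, hv⟩
    · rintro (⟨j, hj, hj', hv⟩ | hv)
      · exact ⟨j, hj, by omega, hv⟩
      · exact ⟨b, by omega, by omega, hv⟩

theorem PathModel.segments {M : ℕ → Set V} {n k : ℕ} (h : PathModel G M n) {e : ℕ → ℕ}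
    (he : ∀ i < k, e i < e (i + 1)) (hk : e k ≤ n) :
    PathModel G (fun i => segment M (e i) (e (i + 1))) k := by
  have hmono : ∀ i j, i ≤ j → j ≤ k → e i ≤ e j := fun i j hij hjk => by
    induction j, hij using Nat.le_induction with
    | base => exact le_rfl
    | succ j hij ih => exact (ih (by omega)).trans (he j (by omega)).le
  refine ⟨fun i hi => h.conn_segment (he i hi) ((hmono _ _ hi le_rfl).trans hk), ?_, fun i hi => ?_⟩
  · rintro i hi j hj v ⟨a, ha, ha', hv⟩ ⟨b, hb, hb', hv'⟩
    have hi' := hmono (i + 1) k hi le_rfl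
    have hj' := hmono (j + 1) k hj le_rfl
    obtain rfl := h.eq_of_mem a (by omega) b (by omega) v hv hv'
    rcases lt_trichotomy i j with hij | hij | hij
    · have := hmono (i + 1) j hij hj.le
      omega
    · exact hij
    · have := hmono (j + 1) i hij hi.le
      omega
  · have h1 := he i (by omega)
    have h2 := he (i + 1) hi
    have h3 := hmono (i + 1 + 1) k hi le_rfl
    obtain ⟨a, ha, b, hb, hab⟩ := h.adj (e (i + 1) - 1) (by omega)
    rw [show e (i + 1) - 1 + 1 = e (i + 1) by omega] at hb
    exact ⟨a, ⟨_, by omega, by omega, ha⟩, b, ⟨_, le_rfl, h2, hb⟩, hab⟩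

theorem isMinor_yurt {P R : ℕ → Set V} {O : Set V} {k : ℕ} (hP : PathModel G P k)
    (hR : PathModel G R k) (hO : Conn G O) (hPR : ∀ i < k, ∀ j < k, Disjoint (P i) (R j))
    (hPO : ∀ i < k, Disjoint (P i) O) (hRO : ∀ i < k, Disjoint (R i) O)
    (aPR : ∀ i < k, ∃ a ∈ P i, ∃ b ∈ R i, G.Adj a b)
    (aRO : ∀ i < k, ∃ a ∈ R i, ∃ b ∈ O, G.Adj a b) : IsMinor (yurt k) G := by
  have two : ∀ x : Fin 2, x = 0 ∨ x = 1 := by decide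
  let M : Option (Fin k × Fin 2) → Set V := fun q =>
    q.elim O fun q => if q.2 = 0 then P q.1 else R q.1
  have hadj : ∀ u v, (match u, v with
      | none, some q => q.2 = 1
      | some p, some q =>
          (p.2 = q.2 ∧ (q.1 : ℕ) = (p.1 : ℕ) + 1) ∨ (p.1 = q.1 ∧ p.2 = 0 ∧ q.2 = 1)
      | _, _ => False) → ∃ a ∈ M u, ∃ b ∈ M v, G.Adj a b := by
    rintro (_ | ⟨i, x⟩) (_ | ⟨j, y⟩) h
    · exact h.elim
    · obtain rfl : y = 1 := h
      obtain ⟨a, ha, b, hb, hab⟩ := aRO j j.2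
      exact ⟨b, hb, a, ha, hab.symm⟩
    · exact h.elim
    · rcases h with ⟨hxy, hij⟩ | ⟨hij, hx, hy⟩
      · obtain rfl : x = y := hxy
        dsimp only at hij
        rcases two x with rfl | rfl
        · simpa [M, hij] using hP.adj i (hij ▸ j.2)
        · simpa [M, hij] using hR.adj i (hij ▸ j.2)
      · dsimp only at hij hx hy
        subst hij hx hy
        simpa [M] using aPR i i.2
  refine ⟨M, ?_, ?_, fun u v huv => ?_⟩
  · rintro (_ | ⟨i, x⟩)
    · exact hO.induce_connected
    · rcases two x with rfl | rfl
      · exact (hP.conn i i.2).induce_connected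
      · exact (hR.conn i i.2).induce_connected
  · have dis : ∀ {M : ℕ → Set V} {i j : Fin k}, PathModel G M k → i ≠ j →
        Disjoint (M i) (M j) := fun {_ i j} h hij =>
      Set.disjoint_left.2 fun v hv hv' => hij (Fin.ext (h.eq_of_mem i i.2 j j.2 v hv hv'))
    rintro (_ | ⟨i, x⟩) (_ | ⟨j, y⟩) hne
    · exact absurd rfl hne
    · rcases two y with rfl | rfl
      · exact (hPO j j.2).symm
      · exact (hRO j j.2).symm
    · rcases two x with rfl | rfl
      · exact hPO i i.2
      · exact hRO i i.2
    · rcases two x with rfl | rfl <;> rcases two y with rfl | rfl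
      · exact dis hP fun h => hne (by simpa using h)
      · exact hPR i i.2 j j.2
      · exact (hPR j j.2 i i.2).symm
      · exact dis hR fun h => hne (by simpa using h)
  · rcases huv.2 with h | h
    · exact hadj u v h
    · obtain ⟨a, ha, b, hb, hab⟩ := hadj v u h
      exact ⟨b, hb, a, ha, hab.symm⟩

theorem isMinor_yurt_of_seq {P R : ℕ → Set V} {O : Set V} {k m n : ℕ} (hP : PathModel G P m)
    (hR : PathModel G R n) (hO : Conn G O) (hPR : ∀ i < m, ∀ j < n, Disjoint (P i) (R j))
    (hPO : ∀ i < m, Disjoint (P i) O) (hRO : ∀ i < n, Disjoint (R i) O) {p r : ℕ → ℕ}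
    (hpm : ∀ i < k, p i < m) (hrn : ∀ i < k, r i < n) (hp : ∀ i, i + 1 < k → p i < p (i + 1))
    (hr : ∀ i, i + 1 < k → r i < r (i + 1))
    (aPR : ∀ i < k, ∃ a ∈ P (p i), ∃ b ∈ R (r i), G.Adj a b)
    (aRO : ∀ i < k, ∃ a ∈ R (r i), ∃ b ∈ O, G.Adj a b) : IsMinor (yurt k) G := by
  let ext (p : ℕ → ℕ) (m i : ℕ) : ℕ := if i < k then p i else m
  have ext_lt : ∀ {p m}, (∀ i < k, p i < m) → (∀ i, i + 1 < k → p i < p (i + 1)) →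
      ∀ i < k, ext p m i < ext p m (i + 1) := fun {p m} hpm hp i hi => by
    by_cases hi' : i + 1 < k
    · simpa [ext, hi, hi'] using hp i hi'
    · simpa [ext, hi, hi'] using hpm i hi
  have ext_le : ∀ {p m}, (∀ i < k, p i < m) → ∀ i, ext p m i ≤ m := fun {p m} hpm i => by
    by_cases hi : i < k
    · simpa [ext, hi] using (hpm i hi).le
    · simp [ext, hi]
  have mem : ∀ {p m i v} {M : ℕ → Set V}, (∀ i < k, p i < m) →
      (∀ i, i + 1 < k → p i < p (i + 1)) → i < k → v ∈ M (p i) →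
      v ∈ segment M (ext p m i) (ext p m (i + 1)) := fun {p m i v M} hpm hp hi hv =>
    ⟨p i, by simp [ext, hi], by simpa [ext, hi] using ext_lt hpm hp i hi, hv⟩
  refine isMinor_yurt (hP.segments (ext_lt hpm hp) (ext_le hpm k))
    (hR.segments (ext_lt hrn hr) (ext_le hrn k)) hO ?_ ?_ ?_ (fun i hi => ?_) fun i hi => ?_
  · refine fun i _ j _ => Set.disjoint_left.2 ?_
    rintro v ⟨a, -, ha, hv⟩ ⟨b, -, hb, hv'⟩
    exact Set.disjoint_left.1 (hPR a (ha.trans_le (ext_le hpm _)) b (hb.trans_le (ext_le hrn _)))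
      hv hv'
  · refine fun i _ => Set.disjoint_left.2 ?_
    rintro v ⟨a, -, ha, hv⟩
    exact Set.disjoint_left.1 (hPO a (ha.trans_le (ext_le hpm _))) hv
  · refine fun i _ => Set.disjoint_left.2 ?_
    rintro v ⟨a, -, ha, hv⟩
    exact Set.disjoint_left.1 (hRO a (ha.trans_le (ext_le hrn _))) hv
  · obtain ⟨a, ha, b, hb, hab⟩ := aPR i hi
    exact ⟨a, mem hpm hp hi ha, b, mem hrn hr hi hb, hab⟩
  · obtain ⟨a, ha, b, hb, hab⟩ := aRO i hi
    exact ⟨a, mem hrn hr hi ha, b, hb, hab⟩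

/-- Two disjoint path models with more than `(k - 1) ^ 2` matching edges between them, whose ends in
the second one lie in sets adjacent to `O`, give a yurt of order `k`. -/
theorem isMinor_yurt_of_matching {ι : Type*} {P R : ℕ → Set V} {O : Set V} {k m n : ℕ}
    (hP : PathModel G P m) (hR : PathModel G R n) (hO : Conn G O)
    (hPR : ∀ i < m, ∀ j < n, Disjoint (P i) (R j)) (hPO : ∀ i < m, Disjoint (P i) O)
    (hRO : ∀ i < n, Disjoint (R i) O) {p r : ι → ℕ} {J : Finset ι} (hJ : (k - 1) ^ 2 < J.card)
    (hpm : ∀ j ∈ J, p j < m) (hrn : ∀ j ∈ J, r j < n) (hp : Set.InjOn p J) (hr : Set.InjOn r J)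
    (aPR : ∀ j ∈ J, ∃ a ∈ P (p j), ∃ b ∈ R (r j), G.Adj a b)
    (aRO : ∀ j ∈ J, ∃ a ∈ R (r j), ∃ b ∈ O, G.Adj a b) : IsMinor (yurt k) G := by
  rw [sq] at hJ
  rcases erdos_szekeres _ _ J hp hr hJ with ⟨c, hc, hlt⟩ | ⟨c, hc, hlt⟩
  · refine isMinor_yurt_of_seq hP hR hO hPR hPO hRO (p := fun i => p (c i)) (r := fun i => r (c i))
      ?_ ?_ ?_ ?_ ?_ ?_
    · exact fun i hi => hpm _ (hc i (by omega))
    · exact fun i hi => hrn _ (hc i (by omega))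
    · exact fun i hi => (hlt i (by omega)).1
    · exact fun i hi => (hlt i (by omega)).2
    · exact fun i hi => aPR _ (hc i (by omega))
    · exact fun i hi => aRO _ (hc i (by omega))
  · have hrev : ∀ i < k, n - 1 - (n - 1 - r (c i)) = r (c i) := fun i hi => by
      have := hrn _ (hc i (by omega))
      omega
    refine isMinor_yurt_of_seq hP hR.reverse hO (fun i hi j hj => hPR i hi _ (by omega)) hPO
      (fun i hi => hRO _ (by omega)) (p := fun i => p (c i)) (r := fun i => n - 1 - r (c i))
      ?_ ?_ ?_ ?_ ?_ ?_
    · exact fun i hi => hpm _ (hc i (by omega))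
    · intro i hi
      have := hrn _ (hc i (by omega))
      omega
    · exact fun i hi => (hlt i (by omega)).1
    · intro i hi
      have := hrn _ (hc i (by omega))
      have := (hlt i (by omega)).2
      omega
    · intro i hi
      rw [hrev i hi]
      exact aPR _ (hc i (by omega))
    · intro i hi
      rw [hrev i hi]
      exact aRO _ (hc i (by omega))

/-! ### Partitions into connected sets -/

/-- Disjoint connected subsets of a connected set `K` extend to a partition of `K` into connected
sets. -/
theorem Conn.exists_partition [Finite V] {ι : Type*} [Finite ι] [Nonempty ι] {K : Set V}
    (hK : Conn G K) {I : ι → Set V} (hI : ∀ i, Conn G (I i)) (hIK : ∀ i, I i ⊆ K)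
    (hd : Pairwise fun i j => Disjoint (I i) (I j)) :
    ∃ F : ι → Set V, (∀ i, Conn G (F i)) ∧ (∀ i, I i ⊆ F i) ∧ (∀ i, F i ⊆ K) ∧
      (∀ i j v, v ∈ F i → v ∈ F j → i = j) ∧ ∀ v ∈ K, ∃ i, v ∈ F i := by
  classical
  obtain ⟨F, ⟨hFc, hIF, hFK, hFd⟩, hmax⟩ := (Set.toFinite {F : ι → Set V | (∀ i, Conn G (F i)) ∧
    (∀ i, I i ⊆ F i) ∧ (∀ i, F i ⊆ K) ∧ ∀ i j v, v ∈ F i → v ∈ F j → i = j}).exists_maximal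
    ⟨I, hI, fun _ => le_rfl, hIK, fun i j v hv hv' => by
      by_contra hne
      exact Set.disjoint_left.1 (hd hne) hv hv'⟩
  refine ⟨F, hFc, hIF, hFK, hFd, ?_⟩
  by_contra! hc
  obtain ⟨i₀⟩ := ‹Nonempty ι›
  obtain ⟨a, ha⟩ := (hFc i₀).1
  obtain ⟨u, -, ⟨i, hui⟩, v, hvK, hv, huv⟩ := hK.exists_adj (U := {v | ∃ i, v ∈ F i})
    ⟨a, hFK _ ha, i₀, ha⟩ (by
      obtain ⟨v, hv, h⟩ := hc
      exact ⟨v, hv, fun ⟨i, hi⟩ => h i hi⟩)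
  have hvF : ∀ j, v ∉ F j := fun j hj => hv ⟨j, hj⟩
  let F' : ι → Set V := fun j => if j = i then F i ∪ {v} else F j
  have hmem : ∀ j w, w ∈ F' j ↔ w ∈ F j ∨ j = i ∧ w = v := fun j w => by
    by_cases hj : j = i
    · subst hj
      simp [F', or_comm]
    · simp [F', hj]
  have hle : F ≤ F' := fun j w hw => (hmem j w).2 (.inl hw)
  refine hvF i (hmax (y := F') ⟨fun j => ?_, fun j => (hIF j).trans (hle j), fun j w hw => ?_,
    fun j j' w hw hw' => ?_⟩ hle i ((hmem i v).2 (.inr ⟨rfl, rfl⟩)))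
  · by_cases hj : j = i
    · simpa [F', hj] using (hFc i).union_of_adj (conn_singleton v) hui rfl huv
    · simpa [F', hj] using hFc j
  · rcases (hmem j w).1 hw with h | ⟨-, rfl⟩
    · exact hFK j h
    · exact hvK
  · rcases (hmem j w).1 hw with h | ⟨rfl, rfl⟩ <;> rcases (hmem j' w).1 hw' with h' | ⟨h', h''⟩
    · exact hFd j j' w h h'
    · exact absurd (h'' ▸ h) (hvF j)
    · exact absurd h' (hvF j')
    · exact h'.symm

/-- The graph on the index type of a family of sets, in which two indices are adjacent if there is
an edge between their sets. -/
def quotientGraph {ι : Type*} (G : SimpleGraph V) (F : ι → Set V) : SimpleGraph ι where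
  Adj i j := i ≠ j ∧ ∃ a ∈ F i, ∃ b ∈ F j, G.Adj a b
  symm := ⟨fun _ _ ⟨hij, a, ha, b, hb, hab⟩ => ⟨hij.symm, b, hb, a, ha, hab.symm⟩⟩
  loopless := ⟨fun _ h => h.1 rfl⟩

theorem Conn.connected_quotientGraph {ι : Type*} [Nonempty ι] {K : Set V} (hK : Conn G K)
    {F : ι → Set V} (hF : ∀ i, (F i).Nonempty) (hFK : ∀ i, F i ⊆ K)
    (hd : ∀ i j v, v ∈ F i → v ∈ F j → i = j) (hcover : ∀ v ∈ K, ∃ i, v ∈ F i) :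
    (quotientGraph G F).Connected := by
  obtain ⟨r⟩ := ‹Nonempty ι›
  refine (connected_iff_exists_forall_reachable _).2 ⟨r, fun i => ?_⟩
  obtain ⟨a, ha⟩ := hF r
  obtain ⟨b, hb⟩ := hF i
  obtain ⟨j, hbj, hj⟩ := hK.2 {v | ∃ i, v ∈ F i ∧ (quotientGraph G F).Reachable r i}
    ⟨a, hFK r ha, r, ha, .refl _⟩ (by
      rintro u - ⟨i, hui, hi⟩ v hv huv
      obtain ⟨j, hvj⟩ := hcover v hv
      refine ⟨j, hvj, ?_⟩
      by_cases hij : i = j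
      · exact hij ▸ hi
      · exact hi.trans (Adj.reachable ⟨hij, u, hui, v, hvj, huv⟩)) (hFK i hb)
  exact hd i j b hb hbj ▸ hj

theorem exists_adj_dist_eq {ι : Type*} {Q : SimpleGraph ι} (hQ : Q.Connected) {r v : ι} {d : ℕ}
    (h : Q.dist r v = d + 1) : ∃ u, Q.Adj u v ∧ Q.dist r u = d := by
  obtain ⟨w, hw⟩ := hQ.exists_walk_length_eq_dist r v
  have hadj := w.adj_getVert_succ (i := d) (by omega)
  rw [w.getVert_of_length_le (i := d + 1) (by omega)] at hadj
  refine ⟨_, hadj, ?_⟩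
  have h1 := dist_le (w.take d)
  have h2 := hQ.dist_triangle (u := r) (v := w.getVert d) (w := v)
  rw [dist_eq_one_iff_adj.2 hadj] at h2
  rw [Walk.take_length] at h1
  omega

/-- The sets at distance at most `d` from a given one in the quotient graph have connected union. -/
theorem conn_ball {ι : Type*} {F : ι → Set V} (hF : ∀ i, Conn G (F i))
    (hQ : (quotientGraph G F).Connected) (r : ι) (d : ℕ) :
    Conn G {v | ∃ i, (quotientGraph G F).dist r i ≤ d ∧ v ∈ F i} := by
  have key : ∀ n i, (quotientGraph G F).dist r i = n → ∃ L, Conn G L ∧ F r ⊆ L ∧ F i ⊆ L ∧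
      ∀ v ∈ L, ∃ j, (quotientGraph G F).dist r j ≤ n ∧ v ∈ F j := by
    intro n
    induction n with
    | zero =>
      intro i hi
      obtain rfl := hQ.dist_eq_zero_iff.1 hi
      exact ⟨F r, hF r, le_rfl, le_rfl, fun v hv => ⟨r, hi.le, hv⟩⟩
    | succ n ih =>
      intro i hi
      obtain ⟨j, ⟨-, a, ha, b, hb, hab⟩, hj⟩ := exists_adj_dist_eq hQ hi
      obtain ⟨L, hL, hrL, hjL, hLv⟩ := ih j hj
      refine ⟨L ∪ F i, hL.union_of_adj (hF i) (hjL ha) hb hab, hrL.trans Set.subset_union_left,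
        Set.subset_union_right, ?_⟩
      rintro v (hv | hv)
      · obtain ⟨j, hj, hv⟩ := hLv v hv
        exact ⟨j, by omega, hv⟩
      · exact ⟨i, hi.le, hv⟩
  obtain ⟨a, ha⟩ := (hF r).1
  have := conn_sUnion (G := G) (r := a) (S := {L | Conn G L ∧ F r ⊆ L ∧
    ∀ v ∈ L, ∃ j, (quotientGraph G F).dist r j ≤ d ∧ v ∈ F j})
    ⟨F r, hF r, le_rfl, fun v hv => ⟨r, by simp, hv⟩⟩ (fun _ h => h.1) (fun _ h => h.2.1 ha)
  convert this using 1
  ext v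
  constructor
  · rintro ⟨i, hi, hv⟩
    obtain ⟨L, hL, hrL, hiL, hLv⟩ := key _ i rfl
    refine ⟨L, ⟨hL, hrL, fun v hv => ?_⟩, hiL hv⟩
    obtain ⟨j, hj, hv⟩ := hLv v hv
    exact ⟨j, hj.trans hi, hv⟩
  · rintro ⟨L, hL, hv⟩
    exact hL.2.2 v hv

/-- A connected graph with `t ^ 2` vertices has a path with `t` vertices, or `t` vertices at the
same positive distance from some vertex. -/
theorem exists_path_or_level {ι : Type*} [Fintype ι] {Q : SimpleGraph ι} (hQ : Q.Connected) {t : ℕ}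
    (ht : 0 < t) (hcard : t ^ 2 ≤ Fintype.card ι) :
    (∃ c : ℕ → ι, Set.InjOn c (Set.Iio t) ∧ ∀ i, i + 1 < t → Q.Adj (c i) (c (i + 1))) ∨
    ∃ r d, t ≤ (Finset.univ.filter fun i => Q.dist r i = d + 1).card := by
  obtain ⟨r⟩ := hQ.nonempty
  by_cases h : ∃ v, t ≤ Q.dist r v + 1
  · obtain ⟨v, hv⟩ := h
    obtain ⟨w, hw, hlen⟩ := hQ.exists_path_of_dist r v
    refine .inl ⟨w.getVert, hw.getVert_injOn.mono fun i hi => ?_, fun i hi =>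
      w.adj_getVert_succ (by omega)⟩
    have : i < t := hi
    exact (by omega : i ≤ w.length)
  · push Not at h
    obtain ⟨t, rfl⟩ : ∃ t', t = t' + 1 := ⟨t - 1, by omega⟩
    obtain ⟨d, -, hd⟩ := Finset.exists_lt_card_fiber_of_mul_lt_card_of_maps_to
      (s := Finset.univ) (t := Finset.range t) (f := Q.dist r) (n := t)
      (fun v _ => Finset.mem_range.2 (by have := h v; omega)) (by
        rw [Finset.card_range, Finset.card_univ]
        nlinarith)
    rcases d with _ | d
    · have h1 : (Finset.univ.filter fun i => Q.dist r i = 0) ⊆ {r} := fun i hi =>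
        Finset.mem_singleton.2 (hQ.dist_eq_zero_iff.1 (Finset.mem_filter.1 hi).2).symm
      have h2 := Finset.card_le_card h1
      have h3 := h r
      rw [Finset.card_singleton] at h2
      omega
    · exact .inr ⟨r, d, hd⟩

/-! ### The main theorem -/

/-- Some initial part of a rooted model covers exactly half of the roots. -/
theorem RootedModel.exists_ncard_eq [Finite V] {K : Set V} {M : ℕ → Set V} {n s : ℕ}
    (h : RootedModel G K M n) (hs : s ≤ (nbr G K).ncard) :
    ∃ m ≤ n, {v | v ∈ nbr G K ∧ ∃ i < m, v ∈ M i}.ncard = s := by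
  classical
  let f : ℕ → ℕ := fun m => {v | v ∈ nbr G K ∧ ∃ i < m, v ∈ M i}.ncard
  have hn : s ≤ f n := hs.trans (Set.ncard_le_ncard (fun v hv => ⟨hv, h.mem_of_nbr v hv⟩)
    (Set.toFinite _))
  have hex : ∃ m, s ≤ f m := ⟨n, hn⟩
  have hmn := Nat.find_min' hex hn
  refine ⟨_, hmn, le_antisymm ?_ (Nat.find_spec hex)⟩
  change f (Nat.find hex) ≤ s
  rcases hm : Nat.find hex with _ | m
  · simp [f]
  · have hlt : f m < s := not_le.1 (Nat.find_min hex (by omega))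
    have hstep : f (m + 1) ≤ f m + ({v | v ∈ nbr G K ∧ v ∈ M m} : Set V).ncard := by
      refine (Set.ncard_le_ncard ?_ (Set.toFinite _)).trans (Set.ncard_union_le _ _)
      rintro v ⟨hv, i, hi, hvi⟩
      by_cases him : i = m
      · exact .inr ⟨hv, him ▸ hvi⟩
      · exact .inl ⟨hv, i, by omega, hvi⟩
    have hone : ({v | v ∈ nbr G K ∧ v ∈ M m} : Set V).ncard ≤ 1 :=
      (Set.ncard_le_one (Set.toFinite _)).2 fun a ha b hb =>
        h.unique m (by omega) a ha.2 b hb.2 ha.1 hb.1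
    omega

/-- Two disjoint path models outside `K` whose sets are linked, in pairs, by `t ^ 2` disjoint
connected subsets of the connected set `K` give a yurt. -/
theorem isMinor_yurt_of_linked [Finite V] {K : Set V} {M : ℕ → Set V} {m n k t : ℕ}
    (hK : Conn G K) (hM : PathModel G M n) (hmn : m ≤ n) (hMK : ∀ i < n, ∀ v ∈ M i, v ∉ K)
    (ht : (k - 1) ^ 2 < t) {I : Fin (t ^ 2) → Set V} (hI : ∀ i, Conn G (I i))
    (hIK : ∀ i, I i ⊆ K) (hd : Pairwise fun i j => Disjoint (I i) (I j)) {p q : Fin (t ^ 2) → ℕ}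
    (hp : Function.Injective p) (hq : Function.Injective q) (hpm : ∀ i, p i < m)
    (hmq : ∀ i, m ≤ q i) (hqn : ∀ i, q i < n) (hpI : ∀ i, ∃ a ∈ M (p i), ∃ b ∈ I i, G.Adj a b)
    (hqI : ∀ i, ∃ a ∈ M (q i), ∃ b ∈ I i, G.Adj a b) : IsMinor (yurt k) G := by
  classical
  have ht0 : 0 < t := by omega
  have : Nonempty (Fin (t ^ 2)) := ⟨⟨0, by positivity⟩⟩
  obtain ⟨F, hF, hIF, hFK, hFd, hcover⟩ := hK.exists_partition hI hIK hd
  have hQ := hK.connected_quotientGraph (fun i => (hF i).1) hFK hFd hcover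
  have hMF : ∀ {i j v}, i < n → v ∈ M i → v ∉ F j := fun hi hv hv' => hMK _ hi _ hv (hFK _ hv')
  have hMM : ∀ {i j v}, i < m → m ≤ j → j < n → v ∈ M i → v ∉ M j := fun hi hj hj' hv hv' => by
    have := hM.eq_of_mem _ (by omega) _ hj' _ hv hv'
    omega
  rcases exists_path_or_level hQ ht0 (by simp) with ⟨c, hc, hadj⟩ | ⟨r, d, hL⟩
  · have hR : PathModel G (fun j => F (c j)) t := by
      refine ⟨fun i _ => hF _, fun i hi j hj v hv hv' => hc hi hj (hFd _ _ v hv hv'),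
        fun i hi => (hadj i hi).2⟩
    have hO := hM.conn_segment (a := m) (b := n)
      ((hmq ⟨0, by positivity⟩).trans_lt (hqn _)) le_rfl
    refine isMinor_yurt_of_matching (hM.take hmn) hR hO (fun i hi j _ => ?_) (fun i hi => ?_)
      (fun i hi => ?_) (p := fun j => p (c j)) (r := id) (J := Finset.range t)
      (by rwa [Finset.card_range]) (fun j _ => hpm _) (fun j hj => Finset.mem_range.1 hj) ?_
      Function.injective_id.injOn (fun j _ => ?_) fun j _ => ?_
    · exact Set.disjoint_left.2 fun v hv => hMF (hi.trans_le hmn) hv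
    · exact Set.disjoint_left.2 fun v hv ⟨j, hj, hj', hv'⟩ => hMM hi hj hj' hv hv'
    · exact Set.disjoint_left.2 fun v hv ⟨j, hj, hj', hv'⟩ => hMF hj' hv' hv
    · exact fun i hi j hj hij => hc (by simpa using hi) (by simpa using hj) (hp hij)
    · obtain ⟨a, ha, b, hb, hab⟩ := hpI (c j)
      exact ⟨a, ha, b, hIF _ hb, hab⟩
    · obtain ⟨a, ha, b, hb, hab⟩ := hqI (c j)
      exact ⟨b, hIF _ hb, a, ⟨_, hmq _, hqn _, ha⟩, hab.symm⟩
  · let Q := quotientGraph G F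
    let L : Finset (Fin (t ^ 2)) := Finset.univ.filter fun i => Q.dist r i = d + 1
    have hLd : ∀ i ∈ L, Q.dist r i = d + 1 := fun i hi => (Finset.mem_filter.1 hi).2
    let R : ℕ → Set V := fun j => {v | v ∈ M (m + j) ∨ ∃ i ∈ L, q i = m + j ∧ v ∈ F i}
    have hR : PathModel G R (n - m) := by
      refine ⟨fun j hj => ?_, ?_, fun j hj => ?_⟩
      · by_cases h : ∃ i ∈ L, q i = m + j
        · obtain ⟨i, hi, hij⟩ := h
          obtain ⟨a, ha, b, hb, hab⟩ := hqI i
          rw [hij] at ha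
          convert (hM.conn (m + j) (by omega)).union_of_adj (hF i) ha (hIF i hb) hab using 1
          ext v
          constructor
          · rintro (hv | ⟨i', hi', hij', hv⟩)
            · exact .inl hv
            · exact .inr (hq (hij.trans hij'.symm) ▸ hv)
          · exact Or.imp_right fun hv => ⟨i, hi, hij, hv⟩
        · convert hM.conn (m + j) (by omega) using 1
          ext v
          constructor
          · rintro (hv | ⟨i, hi, hij, hv⟩)
            · exact hv
            · exact absurd ⟨i, hi, hij⟩ h
          · exact .inl
      · rintro j hj j' hj' v (hv | ⟨i, -, hij, hv⟩) (hv' | ⟨i', -, hij', hv'⟩)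
        · have := hM.eq_of_mem _ (by omega) _ (by omega) v hv hv'
          omega
        · exact absurd hv' (hMF (by omega) hv)
        · exact absurd hv (hMF (by omega) hv')
        · obtain rfl := hFd _ _ _ hv hv'
          omega
      · obtain ⟨a, ha, b, hb, hab⟩ := hM.adj (m + j) (by omega)
        exact ⟨a, .inl ha, b, .inl hb, hab⟩
    refine isMinor_yurt_of_matching (hM.take hmn) hR (conn_ball hF hQ r d) (fun i hi j hj => ?_)
      (fun i hi => ?_) (fun i hi => ?_) (p := p) (r := fun i => q i - m) (J := L)
      (ht.trans_le hL) (fun j _ => hpm j) (fun j _ => ?_) hp.injOn (fun i _ j _ hij => ?_)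
      (fun j hj => ?_) fun j hj => ?_
    · refine Set.disjoint_left.2 ?_
      rintro v hv (hv' | ⟨i', -, -, hv'⟩)
      · exact hMM hi (by omega) (by omega) hv hv'
      · exact hMF (by omega) hv hv'
    · exact Set.disjoint_left.2 fun v hv ⟨j, _, hv'⟩ => hMF (by omega) hv hv'
    · refine Set.disjoint_left.2 ?_
      rintro v (hv | ⟨j, hj, -, hv⟩) ⟨j', hj', hv'⟩
      · exact hMF (by omega) hv hv'
      · obtain rfl := hFd _ _ _ hv hv'
        have := hj'.trans_lt (Nat.lt_succ_self d)
        exact this.ne (hLd j hj)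
    · have := hqn j
      have := hmq j
      omega
    · have := hmq i
      have := hmq j
      exact hq (by simp only at hij; omega)
    · obtain ⟨a, ha, b, hb, hab⟩ := hpI j
      have := hmq j
      exact ⟨a, ha, b, .inr ⟨j, hj, by omega, hIF _ hb⟩, hab⟩
    · obtain ⟨u, ⟨-, a, ha, b, hb, hab⟩, hu⟩ := exists_adj_dist_eq hQ (hLd j hj)
      have := hmq j
      exact ⟨b, .inr ⟨j, hj, by omega, hb⟩, a, ⟨u, hu.le, ha⟩, hab.symm⟩

theorem isMinor_yurt_of_not_small [Finite V] {N k t : ℕ} (ht : (k - 1) ^ 2 < t)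
    (hN : 3 * t ^ 2 ≤ N + 1) (hG : ¬ Small G N Set.univ) : IsMinor (yurt k) G := by
  obtain ⟨K, M, n, hK, hM, hcard, hlink⟩ := exists_rooted_linked hN hG
  obtain ⟨m, hmn, hX⟩ := hM.exists_ncard_eq (s := t ^ 2) (by omega)
  generalize hXdef : {v | v ∈ nbr G K ∧ ∃ i < m, v ∈ M i} = X at hX
  have hXK : X ⊆ nbr G K := hXdef ▸ fun v hv => hv.1
  have hY : (nbr G K \ X).ncard = t ^ 2 := by
    rw [Set.ncard_sdiff hXK, hcard, hX]
    omega
  obtain ⟨P, hPc, hPd, hPX, hPY⟩ := hlink X (nbr G K \ X) (Set.union_sdiff_cancel hXK) hX hY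
  choose x hx using hPX
  choose y hy using hPY
  have hxP : ∀ i, x i ∈ P i ∧ x i ∈ X := fun i => by
    have : x i ∈ P i ∩ X := hx i ▸ rfl
    exact this
  have hyP : ∀ i, y i ∈ P i ∧ y i ∈ nbr G K \ X := fun i => by
    have : y i ∈ P i ∩ (nbr G K \ X) := hy i ▸ rfl
    exact this
  have hPeq : ∀ {i j v}, v ∈ P i → v ∈ P j → i = j := fun {i j v} hv hv' => by
    by_contra hne
    exact Set.disjoint_left.1 (hPd hne) hv hv'
  have hP : ∀ i, ∃ I ⊆ P i \ {x i, y i}, Conn (edgesAt G K) I ∧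
      (∃ u ∈ I, (edgesAt G K).Adj (x i) u) ∧ ∃ u ∈ I, (edgesAt G K).Adj (y i) u := fun i =>
    (hPc i).exists_between (hxP i).1 (hyP i).1 (fun h => (hyP i).2.2 (h ▸ (hxP i).2)) fun h =>
      h.2.elim (hXK (hxP i).2).1 (hyP i).2.1.1
  choose I hIP hI hxI hyI using hP
  have hp : ∀ i, ∃ j < m, x i ∈ M j := fun i => by
    have := (hxP i).2
    rw [← hXdef] at this
    exact this.2
  have hq : ∀ i, ∃ j < n, y i ∈ M j := fun i => hM.mem_of_nbr _ (hyP i).2.1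
  choose p hpm hxM using hp
  choose q hqn hyM using hq
  refine isMinor_yurt_of_linked hK hM.toPathModel hmn hM.notMem ht
    (fun i => (hI i).mono (edgesAt_le G K)) (fun i v hv => ?_) (fun i j hij => ?_) (p := p) (q := q)
    (fun i j hij => ?_) (fun i j hij => ?_) hpm (fun i => ?_) hqn (fun i => ?_) fun i => ?_
  · obtain ⟨hvP, hvxy⟩ := hIP i hv
    have hsub := (hPc i).subset_of_adj (hxP i).1 (.inr (hXK (hxP i).2) : x i ∈ K ∪ nbr G K)
      fun u v => mem_of_edgesAt
    refine (hsub hvP).resolve_right fun hvK => hvxy ?_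
    by_cases hvX : v ∈ X
    · exact .inl ((hx i).subset ⟨hvP, hvX⟩)
    · exact .inr ((hy i).subset ⟨hvP, hvK, hvX⟩)
  · exact (hPd hij).mono (fun v hv => (hIP i hv).1) fun v hv => (hIP j hv).1
  · have hxij := hM.unique (p j) ((hpm j).trans_le hmn) (x i) (hij ▸ hxM i) (x j) (hxM j)
      (hXK (hxP i).2) (hXK (hxP j).2)
    exact hPeq (hxP i).1 (hxij ▸ (hxP j).1)
  · have hyij := hM.unique (q j) (hqn j) (y i) (hij ▸ hyM i) (y j) (hyM j) (hyP i).2.1 (hyP j).2.1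
    exact hPeq (hyP i).1 (hyij ▸ (hyP j).1)
  · by_contra! hlt
    refine (hyP i).2.2 ?_
    rw [← hXdef]
    exact ⟨(hyP i).2.1, q i, hlt, hyM i⟩
  · obtain ⟨u, hu, hxu⟩ := hxI i
    exact ⟨x i, hxM i, u, hu, hxu.1⟩
  · obtain ⟨u, hu, hyu⟩ := hyI i
    exact ⟨y i, hyM i, u, hu, hyu.1⟩

end YurtMinor

/-- If `k > 0` and `tw(G) ≥ 6k⁴ - 24k³ + 48k² - 48k + 23`, then `G` contains the yurt
graph of order `k` as a minor. -/
theorem yurt_minor_of_treewidth {V : Type*} [Fintype V] (k : ℕ) (hk : 0 < k)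
    (G : SimpleGraph V)
    (htw : (treewidth G : ℤ) ≥
      6 * (k : ℤ) ^ 4 - 24 * (k : ℤ) ^ 3 + 48 * (k : ℤ) ^ 2 - 48 * k + 23) :
    IsMinor (yurt k) G := by
  obtain ⟨k, rfl⟩ : ∃ l, k = l + 1 := ⟨k - 1, by omega⟩
  refine YurtMinor.isMinor_yurt_of_not_small (N := 6 * (k ^ 2 + 1) ^ 2 - 1) (t := k ^ 2 + 1)
    (by simp) ?_ fun hsmall => ?_
  · have : 0 < (k ^ 2 + 1) ^ 2 := by positivity
    omega
  · have hpos : 0 < (k ^ 2 + 1) ^ 2 := by positivity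
    rw [show 6 * (k ^ 2 + 1) ^ 2 - 1 = 6 * (k ^ 2 + 1) ^ 2 - 2 + 1 by omega] at hsmall
    have hle := YurtMinor.treewidth_le_of_small hsmall
    have hlt : treewidth G + 2 ≤ 6 * (k ^ 2 + 1) ^ 2 := by omega
    zify at hlt
    push_cast at htw
    linarith
end

section
/- Let k > 0 be an integer and let C be the comb of order k⁴ − 4k³ + 8k² − 8k + 4. Then every graph H ∈ Λ(C) contains the yurt graph Y_k as a minor. -/
/-- A vertex is a leaf of a graph if it has exactly one neighbour (degree 1). -/
def IsLeaf {V : Type*} (T : SimpleGraph V) (v : V) : Prop := ∃! u, T.Adj v u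

/-- The comb of order `r` : the tree obtained from the path `p_1 … p_r` (the vertices
`(i, 0)`) by adding the teeth `v_1, …, v_r` (the vertices `(i, 1)`) and the edges
`{p_i, v_i}`. -/
def comb (r : ℕ) : SimpleGraph (Fin r × Fin 2) :=
  SimpleGraph.fromRel (fun u v =>
    (u.2 = 0 ∧ v.2 = 0 ∧ (v.1 : ℕ) = (u.1 : ℕ) + 1) ∨
    (u.1 = v.1 ∧ u.2 = 0 ∧ v.2 = 1))

/-- The graph obtained from the disjoint union of a graph `T`, a path on `p` vertices
(the vertices `inr (some i)`) and an extra vertex `v_new` (the vertex `inr none`) by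
adding an edge between `v_new` and every vertex of the path, and the `p` pairwise
disjoint edges `{path vertex i, m i}` where `m : Fin p → V`. -/
def lambdaGraph {V : Type*} (T : SimpleGraph V) (p : ℕ) (m : Fin p → V) :
    SimpleGraph (V ⊕ Option (Fin p)) :=
  SimpleGraph.fromRel (fun u v =>
    match u, v with
    | Sum.inl a, Sum.inl b => T.Adj a b
    | Sum.inr (some i), Sum.inr (some j) => (j : ℕ) = (i : ℕ) + 1
    | Sum.inr none, Sum.inr (some _) => True
    | Sum.inl a, Sum.inr (some i) => m i = a
    | _, _ => False)

/-- Erdős–Szekeres: an injective function on a finite set with more than `a * b` elements is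
strictly increasing along some `a + 1` points or strictly decreasing along some `b + 1` points. -/
theorem exists_strictMono_or_strictAnti_comp {α β : Type*} [LinearOrder α] [LinearOrder β]
    {f : α → β} (hf : Function.Injective f) (a b : ℕ) (s : Finset α) (hs : a * b < s.card) :
    (∃ g : Fin (a + 1) → α, (∀ i, g i ∈ s) ∧ StrictMono g ∧ StrictMono (f ∘ g)) ∨
      ∃ g : Fin (b + 1) → α, (∀ i, g i ∈ s) ∧ StrictMono g ∧ StrictAnti (f ∘ g) := by
  induction a generalizing s with
  | zero =>
    obtain ⟨x, hx⟩ := Finset.card_pos.mp (by omega : 0 < s.card)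
    exact Or.inl ⟨fun _ => x, fun _ => hx, Subsingleton.strictMono (α := Fin 1) _,
      Subsingleton.strictMono (α := Fin 1) _⟩
  | succ a ih =>
    classical
    set t := s.filter fun i => ∀ j ∈ s, j < i → f i ≤ f j with ht
    by_cases hcard : b + 1 ≤ t.card
    · right
      have hmem : ∀ i, t.orderEmbOfCardLe hcard i ∈ t := fun i =>
        Finset.orderEmbOfCardLe_mem t hcard i
      refine ⟨t.orderEmbOfCardLe hcard, fun i => Finset.mem_of_mem_filter _ (hmem i),
        (t.orderEmbOfCardLe hcard).strictMono, fun i j hij => ?_⟩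
      have hlt := (t.orderEmbOfCardLe hcard).strictMono hij
      exact lt_of_le_of_ne
        ((Finset.mem_filter.mp (hmem j)).2 _ (Finset.mem_of_mem_filter _ (hmem i)) hlt)
        (hf.ne hlt.ne')
    · have hsub : t ⊆ s := Finset.filter_subset _ _
      have hdiff : a * b < (s \ t).card := by
        rw [Finset.card_sdiff_of_subset hsub]
        rw [add_mul] at hs
        omega
      rcases ih (s \ t) hdiff with ⟨g, hgs, hg, hfg⟩ | ⟨g, hgs, hg, hfg⟩
      · left
        have h0 := Finset.mem_sdiff.mp (hgs 0)
        obtain ⟨j, hj, hj0, hfj⟩ : ∃ j ∈ s, j < g 0 ∧ f j < f (g 0) := by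
          by_contra! hcon
          exact h0.2 (Finset.mem_filter.mpr ⟨h0.1, hcon⟩)
        refine ⟨Fin.cons j g, fun i => ?_, ?_, ?_⟩
        · cases i using Fin.cases with
          | zero => exact hj
          | succ i => exact (Finset.mem_sdiff.mp (hgs i)).1
        · refine Fin.strictMono_iff_lt_succ.mpr fun i => ?_
          cases i using Fin.cases with
          | zero => simpa using hj0
          | succ i => simpa [← Fin.succ_castSucc] using hg (Fin.castSucc_lt_succ (i := i))
        · refine Fin.strictMono_iff_lt_succ.mpr fun i => ?_
          cases i using Fin.cases with
          | zero => simpa using hfj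
          | succ i => simpa [← Fin.succ_castSucc] using hfg (Fin.castSucc_lt_succ (i := i))
      · exact Or.inr ⟨g, fun i => (Finset.mem_sdiff.mp (hgs i)).1, hg, hfg⟩

/-- Strictly increasing points of a path lie in disjoint, consecutively touching segments. -/
theorem exists_segments_of_strictMono {k n : ℕ} {f : Fin k → Fin n} (hf : StrictMono f) :
    ∃ S : Fin k → Set (Fin n), (∀ j, f j ∈ S j) ∧ (∀ j, (S j).OrdConnected) ∧
      (Pairwise fun i j => Disjoint (S i) (S j)) ∧
      ∀ i j : Fin k, (j : ℕ) = (i : ℕ) + 1 →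
        ∃ a ∈ S i, ∃ b ∈ S j, (b : ℕ) = (a : ℕ) + 1 ∨ (a : ℕ) = (b : ℕ) + 1 := by
  refine ⟨fun j => {c | f j ≤ c ∧ ∀ l, j < l → c < f l}, fun j => ⟨le_rfl, fun l hl => hf hl⟩,
    fun j => ⟨fun x hx y hy z hz => ⟨hx.1.trans hz.1, fun l hl => hz.2.trans_lt (hy.2 l hl)⟩⟩,
    fun i j hij => ?_, fun i j hij => ?_⟩
  · refine Set.disjoint_left.mpr fun c hi hj => ?_
    rcases lt_or_gt_of_ne hij with h | h
    · exact absurd (hi.2 _ h) (not_lt.mpr hj.1)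
    · exact absurd (hj.2 _ h) (not_lt.mpr hi.1)
  · have hlt : i < j := Fin.lt_def.mpr (by omega)
    have hflt : (f i : ℕ) < f j := hf hlt
    refine ⟨⟨(f j : ℕ) - 1, by omega⟩, ⟨Fin.le_def.mpr ?_, fun l hl => ?_⟩, f j,
      ⟨le_rfl, fun l hl => hf hl⟩, Or.inl ?_⟩
    · simp only
      omega
    · have hjl : j ≤ l := Fin.le_def.mpr (by have := Fin.lt_def.mp hl; omega)
      have : (f j : ℕ) ≤ f l := hf.monotone hjl
      rw [Fin.lt_def]
      simp only
      omega
    · simp only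
      omega

theorem exists_segments {k n : ℕ} {f : Fin k → Fin n} (hf : StrictMono f ∨ StrictAnti f) :
    ∃ S : Fin k → Set (Fin n), (∀ j, f j ∈ S j) ∧ (∀ j, (S j).OrdConnected) ∧
      (Pairwise fun i j => Disjoint (S i) (S j)) ∧
      ∀ i j : Fin k, (j : ℕ) = (i : ℕ) + 1 →
        ∃ a ∈ S i, ∃ b ∈ S j, (b : ℕ) = (a : ℕ) + 1 ∨ (a : ℕ) = (b : ℕ) + 1 := by
  rcases hf with hf | hf
  · exact exists_segments_of_strictMono hf
  · obtain ⟨S, hmem, hconn, hdisj, hadj⟩ := exists_segments_of_strictMono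
      (f := Fin.rev ∘ f) fun i j hij => Fin.rev_lt_rev.mpr (hf hij)
    refine ⟨fun j => Fin.rev ⁻¹' S j, hmem, fun j => ⟨fun x hx y hy z hz => ?_⟩,
      fun i j hij => (hdisj hij).preimage _, fun i j hij => ?_⟩
    · exact (hconn j).out hy hx ⟨Fin.rev_le_rev.mpr hz.2, Fin.rev_le_rev.mpr hz.1⟩
    · obtain ⟨a, ha, b, hb, hab⟩ := hadj i j hij
      refine ⟨a.rev, by simpa using ha, b.rev, by simpa using hb, ?_⟩
      simp only [Fin.val_rev]
      omega

/-- The image of a nonempty segment of a path in a graph is connected. -/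
theorem SimpleGraph.connected_induce_image_of_ordConnected {V : Type*} {G : SimpleGraph V} {n : ℕ}
    {φ : Fin n → V} (hφ : ∀ i j : Fin n, (j : ℕ) = (i : ℕ) + 1 → G.Adj (φ i) (φ j))
    {S : Set (Fin n)} (hne : S.Nonempty) (hS : S.OrdConnected) :
    (G.induce (φ '' S)).Connected := by
  have key : ∀ d : ℕ, ∀ i j : Fin n, ∀ (hi : i ∈ S) (hj : j ∈ S), (j : ℕ) = (i : ℕ) + d →
      (G.induce (φ '' S)).Reachable ⟨φ i, i, hi, rfl⟩ ⟨φ j, j, hj, rfl⟩ := by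
    intro d
    induction d with
    | zero =>
      intro i j hi hj hij
      obtain rfl : j = i := Fin.ext hij
      exact SimpleGraph.Reachable.refl _
    | succ d ih =>
      intro i j hi hj hij
      let l : Fin n := ⟨(i : ℕ) + d, by omega⟩
      have hl : l ∈ S := hS.out hi hj
        ⟨Fin.le_def.mpr (by simp [l]), Fin.le_def.mpr (by simp [l]; omega)⟩
      refine (ih i l hi hl rfl).trans (SimpleGraph.Adj.reachable ?_)
      exact hφ l j (by simp [l]; omega)
  obtain ⟨x, hx⟩ := hne
  refine SimpleGraph.connected_iff_exists_forall_reachable _ |>.mpr ⟨⟨φ x, x, hx, rfl⟩, ?_⟩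
  rintro ⟨_, y, hy, rfl⟩
  rcases le_total (x : ℕ) y with h | h
  · exact key (y - x) x y hx hy (by omega)
  · exact (key (x - y) y x hy hx (by omega)).symm

section Comb

variable {r : ℕ}

theorem comb_adj_spine {i j : Fin r} (h : (j : ℕ) = (i : ℕ) + 1) :
    (comb r).Adj (i, 0) (j, 0) := by
  refine ⟨fun hij => ?_, Or.inl (Or.inl ⟨rfl, rfl, h⟩)⟩
  simp only [Prod.mk.injEq, and_true] at hij
  subst hij
  omega

theorem comb_adj_tooth (i : Fin r) : (comb r).Adj (i, 0) (i, 1) :=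
  ⟨by simp, Or.inl (Or.inr ⟨rfl, rfl, rfl⟩)⟩

theorem isLeaf_comb_tooth (i : Fin r) : IsLeaf (comb r) (i, 1) := by
  refine ⟨(i, 0), (comb_adj_tooth i).symm, ?_⟩
  rintro ⟨j, c⟩ h
  simp only [comb, SimpleGraph.fromRel_adj] at h
  aesop

theorem snd_eq_one_of_isLeaf_comb (hr : 2 ≤ r) {v : Fin r × Fin 2} (hv : IsLeaf (comb r) v) :
    v.2 = 1 := by
  obtain ⟨i, c⟩ := v
  by_contra hc
  obtain rfl : c = 0 := by simp only at hc; omega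
  obtain ⟨j, hj⟩ : ∃ j : Fin r, (comb r).Adj (i, 0) (j, 0) := by
    by_cases hi : (i : ℕ) + 1 < r
    · exact ⟨⟨i + 1, hi⟩, comb_adj_spine rfl⟩
    · exact ⟨⟨i - 1, by omega⟩, (comb_adj_spine (by simp only; omega)).symm⟩
  simpa using hv.unique hj (comb_adj_tooth i)

theorem le_ncard_isLeaf_comb (r : ℕ) :
    r ≤ Set.ncard {v : Fin r × Fin 2 | IsLeaf (comb r) v} := by
  have hsub : Set.range (fun i : Fin r => (i, (1 : Fin 2))) ⊆ {v | IsLeaf (comb r) v} := by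
    rintro _ ⟨i, rfl⟩
    exact isLeaf_comb_tooth i
  have hcard := Set.ncard_le_ncard hsub (Set.toFinite _)
  rwa [← Set.image_univ, Set.ncard_image_of_injective _ (Prod.mk_left_injective _),
    Set.ncard_univ, Nat.card_fin] at hcard

end Comb

section LambdaGraph

variable {V : Type*} {T : SimpleGraph V} {p : ℕ} {m : Fin p → V}

theorem lambdaGraph_adj_inl {a b : V} (h : T.Adj a b) :
    (lambdaGraph T p m).Adj (Sum.inl a) (Sum.inl b) :=
  ⟨by simpa using h.ne, Or.inl h⟩

theorem lambdaGraph_adj_path {i j : Fin p} (h : (j : ℕ) = (i : ℕ) + 1) :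
    (lambdaGraph T p m).Adj (Sum.inr (some i)) (Sum.inr (some j)) := by
  refine ⟨fun hij => ?_, Or.inl h⟩
  simp only [Sum.inr.injEq, Option.some.injEq] at hij
  subst hij
  omega

theorem lambdaGraph_adj_none (i : Fin p) :
    (lambdaGraph T p m).Adj (Sum.inr none) (Sum.inr (some i)) :=
  ⟨by simp, Or.inl trivial⟩

theorem lambdaGraph_adj_match (i : Fin p) :
    (lambdaGraph T p m).Adj (Sum.inl (m i)) (Sum.inr (some i)) :=
  ⟨by simp, Or.inl rfl⟩

end LambdaGraph

/-- A yurt minor from path vertices `g 0 < g 1 < ⋯` matched to monotone teeth of the comb. -/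
theorem isMinor_yurt_of_strictMono {k r p : ℕ} {m : Fin p → Fin r × Fin 2} {g : Fin k → Fin p}
    (hg : StrictMono g)
    (hmg : StrictMono (fun j => (m (g j)).1) ∨ StrictAnti (fun j => (m (g j)).1)) :
    IsMinor (yurt k) (lambdaGraph (comb r) p m) := by
  obtain ⟨S, hSmem, hSconn, hSdisj, hSadj⟩ := exists_segments hmg
  obtain ⟨P, hPmem, hPconn, hPdisj, hPadj⟩ := exists_segments (Or.inl hg)
  set G := lambdaGraph (comb r) p m
  let spine : Fin r → (Fin r × Fin 2) ⊕ Option (Fin p) := fun c => Sum.inl (c, 0)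
  let top : Fin p → (Fin r × Fin 2) ⊕ Option (Fin p) := fun i => Sum.inr (some i)
  let tooth : Fin k → (Fin r × Fin 2) ⊕ Option (Fin p) := fun j => Sum.inl ((m (g j)).1, 1)
  let bottom : Fin k → Set ((Fin r × Fin 2) ⊕ Option (Fin p)) := fun j => spine '' S j ∪ {tooth j}
  have hspine : ∀ i j : Fin r, (j : ℕ) = (i : ℕ) + 1 → G.Adj (spine i) (spine j) :=
    fun i j h => lambdaGraph_adj_inl (comb_adj_spine h)
  have htop : ∀ i j : Fin p, (j : ℕ) = (i : ℕ) + 1 → G.Adj (top i) (top j) :=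
    fun i j h => lambdaGraph_adj_path h
  have hmbottom : ∀ j, Sum.inl (m (g j)) ∈ bottom j := by
    intro j
    obtain h | h : (m (g j)).2 = 0 ∨ (m (g j)).2 = 1 := by omega
    · exact Or.inl ⟨_, hSmem j, congrArg Sum.inl (Prod.ext rfl h.symm)⟩
    · exact Or.inr (congrArg Sum.inl (Prod.ext rfl h))
  have hbottom : ∀ j, (G.induce (bottom j)).Connected := fun j =>
    SimpleGraph.connected_induce_union (v := spine (m (g j)).1) (w := tooth j)
      (SimpleGraph.connected_induce_image_of_ordConnected hspine ⟨_, hSmem j⟩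
        (hSconn j)).preconnected
      (by rintro ⟨_, rfl⟩ ⟨_, rfl⟩; exact SimpleGraph.Reachable.refl _)
      ⟨_, hSmem j, rfl⟩ rfl (lambdaGraph_adj_inl (comb_adj_tooth _))
  have hteeth : ∀ i j, tooth i = tooth j → i = j := by
    intro i j h
    simp only [tooth, Sum.inl.injEq, Prod.mk.injEq, and_true] at h
    exact hmg.elim (fun hmg => hmg.injective h) fun hmg => hmg.injective h
  have hbdisj : ∀ i j, i ≠ j → Disjoint (bottom i) (bottom j) := by
    intro i j hij
    rw [Set.disjoint_left]
    rintro x (⟨a, ha, rfl⟩ | rfl) (⟨b, hb, hab⟩ | hb)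
    · simp only [spine, Sum.inl.injEq, Prod.mk.injEq, and_true] at hab
      subst hab
      exact Set.disjoint_left.mp (hSdisj hij) ha hb
    · simp [spine, tooth] at hb
    · simp [spine, tooth] at hab
    · exact hij (hteeth i j hb)
  have htdisj : ∀ i j, i ≠ j → Disjoint (top '' P i) (top '' P j) := fun i j hij =>
    (Set.disjoint_image_iff fun a b h => by simpa [top] using h).mpr (hPdisj hij)
  have hbtdisj : ∀ i j, Disjoint (bottom i) (top '' P j) := by
    intro i j
    rw [Set.disjoint_left]
    rintro x (⟨a, ha, rfl⟩ | rfl) ⟨b, hb, hab⟩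
    · simp [spine, top] at hab
    · simp [tooth, top] at hab
  let M : Option (Fin k × Fin 2) → Set ((Fin r × Fin 2) ⊕ Option (Fin p)) := fun u =>
    match u with
    | none => {Sum.inr none}
    | some (j, 0) => bottom j
    | some (j, 1) => top '' P j
  have hadj : ∀ u v : Option (Fin k × Fin 2),
      (match u, v with
        | none, some q => q.2 = 1
        | some p, some q =>
          (p.2 = q.2 ∧ (q.1 : ℕ) = (p.1 : ℕ) + 1) ∨ (p.1 = q.1 ∧ p.2 = 0 ∧ q.2 = 1)
        | _, _ => False) → ∃ a ∈ M u, ∃ b ∈ M v, G.Adj a b := by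
    rintro (_ | ⟨i, c⟩) (_ | ⟨j, d⟩) h
    · exact h.elim
    · obtain rfl : d = 1 := h
      exact ⟨_, rfl, _, ⟨g j, hPmem j, rfl⟩, lambdaGraph_adj_none _⟩
    · exact h.elim
    · rcases h with ⟨hcd, hij⟩ | ⟨hij, hc, hd⟩
      · obtain rfl : c = d := hcd
        obtain rfl | rfl : c = 0 ∨ c = 1 := by omega
        · obtain ⟨a, ha, b, hb, hab⟩ := hSadj i j hij
          exact ⟨_, Or.inl ⟨a, ha, rfl⟩, _, Or.inl ⟨b, hb, rfl⟩,
            hab.elim (hspine a b) fun h => (hspine b a h).symm⟩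
        · obtain ⟨a, ha, b, hb, hab⟩ := hPadj i j hij
          exact ⟨_, ⟨a, ha, rfl⟩, _, ⟨b, hb, rfl⟩,
            hab.elim (htop a b) fun h => (htop b a h).symm⟩
      · obtain rfl : i = j := hij
        obtain rfl : c = 0 := hc
        obtain rfl : d = 1 := hd
        exact ⟨_, hmbottom i, _, ⟨g i, hPmem i, rfl⟩, lambdaGraph_adj_match _⟩
  refine ⟨M, ?_, ?_, ?_⟩
  · rintro (_ | ⟨j, c⟩)
    · exact SimpleGraph.connected_iff_exists_forall_reachable _ |>.mpr
        ⟨⟨_, rfl⟩, by rintro ⟨_, rfl⟩; exact SimpleGraph.Reachable.refl _⟩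
    · obtain rfl | rfl : c = 0 ∨ c = 1 := by omega
      · exact hbottom j
      · exact SimpleGraph.connected_induce_image_of_ordConnected htop ⟨_, hPmem j⟩ (hPconn j)
  · have hnone : ∀ q, Disjoint (M none) (M (some q)) := by
      rintro ⟨j, c⟩
      obtain rfl | rfl : c = 0 ∨ c = 1 := by omega
      · simp [M, bottom, spine, tooth]
      · simp [M, top]
    rintro (_ | ⟨i, c⟩) (_ | ⟨j, d⟩) huv
    · exact absurd rfl huv
    · exact hnone _
    · exact (hnone _).symm
    · obtain rfl | rfl : c = 0 ∨ c = 1 := by omega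
      · obtain rfl | rfl : d = 0 ∨ d = 1 := by omega
        · exact hbdisj i j fun h => huv (by rw [h])
        · exact hbtdisj i j
      · obtain rfl | rfl : d = 0 ∨ d = 1 := by omega
        · exact (hbtdisj j i).symm
        · exact htdisj i j fun h => huv (by rw [h])
  · rintro u v ⟨_, h | h⟩
    · exact hadj u v h
    · obtain ⟨a, ha, b, hb, hab⟩ := hadj v u h
      exact ⟨b, hb, a, ha, hab.symm⟩

/-- If `k > 0` and `C` is the comb of order `k⁴ - 4k³ + 8k² - 8k + 4`, then every
member of `Λ(C)` (the disjoint union of `C`, a path `P` on `p ≥ √|L(C)|` vertices and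
a vertex `v_new` joined to all of `P`, together with `p` pairwise disjoint edges
between the vertices of `P` and the leaves of `C`) contains the yurt graph of order
`k` as a minor. -/
theorem yurt_minor_of_lambda_comb (k : ℕ) (hk : 0 < k) (r : ℕ)
    (hr : (r : ℤ) = (k : ℤ) ^ 4 - 4 * (k : ℤ) ^ 3 + 8 * (k : ℤ) ^ 2 - 8 * k + 4)
    (p : ℕ) (m : Fin p → Fin r × Fin 2)
    (hinj : Function.Injective m)
    (hleaf : ∀ i, IsLeaf (comb r) (m i))
    (hp : Real.sqrt (Set.ncard {v : Fin r × Fin 2 | IsLeaf (comb r) v}) ≤ (p : ℝ)) :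
    IsMinor (yurt k) (lambdaGraph (comb r) p m) := by
  obtain ⟨n, rfl⟩ : ∃ n, k = n + 1 := ⟨k - 1, by omega⟩
  have hrn : r = (n * n + 1) ^ 2 := by
    zify
    rw [hr]
    push_cast
    ring
  have hpn : n * n < p := by
    have hle : (r : ℝ) ≤ (p : ℝ) ^ 2 :=
      (Nat.cast_le.mpr (le_ncard_isLeaf_comb r)).trans (Real.sqrt_le_left (by positivity) |>.mp hp)
    have hle' : (n * n + 1) ^ 2 ≤ p ^ 2 := by
      rw [← hrn]
      exact_mod_cast hle
    exact (Nat.pow_le_pow_iff_left two_ne_zero).mp hle'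
  rcases Nat.eq_zero_or_pos n with rfl | hn
  · exact isMinor_yurt_of_strictMono (g := fun _ => ⟨0, by omega⟩)
      (Subsingleton.strictMono (α := Fin 1) _) (Or.inl (Subsingleton.strictMono (α := Fin 1) _))
  · have hr2 : 2 ≤ r := by
      rw [hrn]
      nlinarith [Nat.mul_pos hn hn]
    have hfst : Function.Injective fun i => (m i).1 := fun i j hij =>
      hinj (Prod.ext hij ((snd_eq_one_of_isLeaf_comb hr2 (hleaf i)).trans
        (snd_eq_one_of_isLeaf_comb hr2 (hleaf j)).symm))
    rcases exists_strictMono_or_strictAnti_comp hfst n n Finset.univ (by simpa using hpn) with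
      ⟨g, -, hg, hmg⟩ | ⟨g, -, hg, hmg⟩
    · exact isMinor_yurt_of_strictMono hg (Or.inl hmg)
    · exact isMinor_yurt_of_strictMono hg (Or.inr hmg)
end
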